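/- arXiv:1210.6429 — 2 statements merged into one kernel-verified Lean document; each statement's English description precedes it below -/
import Mathlib

section
/- Fix a real ε with 0 < ε < 2. There exist constants C₁, C₂ > 0 (depending only on ε) such that for every prime p and every integer h with 3 ≤ h ≤ p^{1/(2+ε/2)}, the number of elements s ∈ F_p for which |K_2(p,h,s) − 2h²| > h^{2−ε/2}·exp(C₁·log h/log log h) is at most C₂·h^{1+ε}. -/
theorem Nat.card_divisors_le_mul_exp (n : ℕ) (hn : n ≠ 0) (t : ℝ) (ht : 1 < t) :
    (n.divisors.card : ℝ) ≤ (1 + Real.log n / Real.log 2) ^ ⌊t⌋₊ *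
      Real.exp (Real.log 2 / Real.log t * Real.log n) := by
  have hl2 : 0 < Real.log 2 := Real.log_pos (by norm_num)
  have hlt : 0 < Real.log t := Real.log_pos ht
  have hlog : Real.log n = ∑ q ∈ n.primeFactors, (n.factorization q : ℝ) * Real.log q := by
    conv_lhs => rw [← Nat.prod_factorization_pow_eq_self hn]
    rw [Finsupp.prod, Nat.cast_prod, Real.log_prod]
    · simp
    · intro q hq
      have := (Nat.prime_of_mem_primeFactors (by simpa using hq)).pos
      positivity
  have hterm : ∀ q ∈ n.primeFactors, 0 ≤ (n.factorization q : ℝ) * Real.log q := fun q _ =>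
    mul_nonneg (Nat.cast_nonneg _) (Real.log_natCast_nonneg q)
  set A : ℝ := 1 + Real.log n / Real.log 2 with hA
  have hA1 : 1 ≤ A := by
    have : 0 ≤ Real.log n / Real.log 2 := div_nonneg (Real.log_natCast_nonneg n) hl2.le
    linarith
  set c : ℝ := Real.log 2 / Real.log t with hc
  have hc0 : 0 < c := _root_.div_pos hl2 hlt
  have hfac : ∀ q ∈ n.primeFactors, ((n.factorization q + 1 : ℕ) : ℝ) ≤
      (if (q : ℝ) ≤ t then A else 1) *
        Real.exp (c * ((n.factorization q : ℝ) * Real.log q)) := by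
    intro q hq
    have hqp := Nat.prime_of_mem_primeFactors hq
    have hq2 : (2 : ℝ) ≤ q := by exact_mod_cast hqp.two_le
    split_ifs with hqt
    · have h1 : (n.factorization q : ℝ) * Real.log 2 ≤ Real.log n := by
        calc (n.factorization q : ℝ) * Real.log 2 ≤ (n.factorization q : ℝ) * Real.log q := by
              gcongr
          _ ≤ Real.log n := by
              rw [hlog]; exact Finset.single_le_sum hterm hq
      have h2 : ((n.factorization q + 1 : ℕ) : ℝ) ≤ A := by
        push_cast
        have := (le_div_iff₀ hl2).2 h1
        linarith
      have h3 : 1 ≤ Real.exp (c * ((n.factorization q : ℝ) * Real.log q)) :=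
        Real.one_le_exp (mul_nonneg hc0.le (hterm q hq))
      nlinarith
    · push Not at hqt
      have h1 : Real.log t ≤ Real.log q := Real.log_le_log (by linarith) hqt.le
      have h2 : ((n.factorization q + 1 : ℕ) : ℝ) ≤ 2 ^ (n.factorization q) := by
        exact_mod_cast Nat.lt_two_pow_self
      have h3 : (2 : ℝ) ^ (n.factorization q) =
          Real.exp ((n.factorization q : ℝ) * Real.log 2) := by
        rw [Real.exp_nat_mul, Real.exp_log (by norm_num)]
      rw [one_mul]
      refine h2.trans (h3.le.trans (Real.exp_le_exp.2 ?_))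
      have h4 : Real.log 2 ≤ c * Real.log q := by
        rw [hc, div_mul_eq_mul_div, le_div_iff₀ hlt]
        gcongr
      calc (n.factorization q : ℝ) * Real.log 2 ≤ n.factorization q * (c * Real.log q) := by
            gcongr
        _ = _ := by ring
  rw [Nat.card_divisors hn, Nat.cast_prod]
  refine (Finset.prod_le_prod (fun _ _ => Nat.cast_nonneg _) hfac).trans ?_
  rw [Finset.prod_mul_distrib, ← Real.exp_sum, ← Finset.mul_sum, ← hlog, Finset.prod_ite,
    Finset.prod_const, Finset.prod_const_one, mul_one]
  gcongr ?_ * _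
  refine pow_le_pow_right₀ hA1 ?_
  · calc _ ≤ (Finset.Icc 1 ⌊t⌋₊).card := by
          apply Finset.card_le_card
          intro q hq
          simp only [Finset.mem_filter] at hq
          exact Finset.mem_Icc.2 ⟨(Nat.prime_of_mem_primeFactors hq.1).pos,
            Nat.le_floor hq.2⟩
      _ = _ := by simp

theorem one_le_div_log {x : ℝ} (hx : 1 < x) : 1 ≤ x / Real.log x := by
  rw [le_div_iff₀ (Real.log_pos hx), one_mul]
  linarith [Real.log_le_sub_one_of_pos (by linarith : 0 < x)]

theorem one_lt_log_natCast {h : ℕ} (hh : 3 ≤ h) : 1 < Real.log h := by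
  rw [Real.lt_log_iff_exp_lt (by positivity)]
  have : (3 : ℝ) ≤ h := by exact_mod_cast hh
  linarith [Real.exp_one_lt_d9]

theorem exists_card_divisors_le_exp : ∃ C : ℝ, 0 < C ∧ ∀ h : ℕ, 3 ≤ h → ∀ m : ℕ, m ≠ 0 →
    m ≤ h ^ 2 → (m.divisors.card : ℝ) ≤ Real.exp (C * Real.log h / Real.log (Real.log h)) := by
  refine ⟨48, by norm_num, fun h hh m hm hmh => ?_⟩
  have hL := one_lt_log_natCast hh
  set L := Real.log h with hLdef
  have hlL : 0 < Real.log L := Real.log_pos hL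
  have hl2 : 0 < Real.log 2 := Real.log_pos (by norm_num)
  have hl2' : Real.log 2 < 1 := by linarith [Real.log_two_lt_d9]
  have hl2'' : 1 / 2 < Real.log 2 := by linarith [Real.log_two_gt_d9]
  have hlm : Real.log m ≤ 2 * L := by
    have : Real.log m ≤ Real.log ((h : ℝ) ^ 2) :=
      Real.log_le_log (by positivity) (by exact_mod_cast hmh)
    rwa [Real.log_pow] at this
  have ht : 1 < L ^ (1 / 2 : ℝ) := Real.one_lt_rpow hL (by norm_num)
  refine (Nat.card_divisors_le_mul_exp m hm _ ht).trans ?_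
  rw [Real.log_rpow (by linarith)]
  have hm0 : 0 ≤ Real.log m := Real.log_natCast_nonneg m
  have hA0 : 0 ≤ Real.log m / Real.log 2 := by positivity
  have hA : 1 + Real.log m / Real.log 2 ≤ 5 * L := by
    have : Real.log m / Real.log 2 ≤ 4 * L := by
      rw [div_le_iff₀ hl2]; nlinarith
    linarith
  have hpow : (1 + Real.log m / Real.log 2) ^ ⌊L ^ (1 / 2 : ℝ)⌋₊ ≤
      Real.exp (L ^ (1 / 2 : ℝ) * Real.log (5 * L)) := by
    calc (1 + Real.log m / Real.log 2) ^ ⌊L ^ (1 / 2 : ℝ)⌋₊ ≤ (5 * L) ^ ⌊L ^ (1 / 2 : ℝ)⌋₊ := by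
          gcongr
      _ = Real.exp (⌊L ^ (1 / 2 : ℝ)⌋₊ * Real.log (5 * L)) := by
          rw [Real.exp_nat_mul, Real.exp_log (by positivity)]
      _ ≤ _ := by
          have : 0 ≤ Real.log (5 * L) := Real.log_nonneg (by linarith)
          have := Nat.floor_le (by positivity : 0 ≤ L ^ (1 / 2 : ℝ))
          gcongr
  refine (mul_le_mul_of_nonneg_right hpow (Real.exp_pos _).le).trans ?_
  rw [← Real.exp_add, Real.exp_le_exp, le_div_iff₀ hlL, add_mul]
  have e1 : Real.log L ≤ 4 * L ^ (1 / 4 : ℝ) := by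
    have := Real.log_le_rpow_div (by linarith : 0 ≤ L) (by norm_num : (0 : ℝ) < 1 / 4)
    linarith
  have e2 : Real.log (5 * L) ≤ 8 * L ^ (1 / 4 : ℝ) := by
    have h1 := Real.log_le_rpow_div (by linarith : 0 ≤ 5 * L) (by norm_num : (0 : ℝ) < 1 / 4)
    have h2 : (5 * L) ^ (1 / 4 : ℝ) ≤ 2 * L ^ (1 / 4 : ℝ) := by
      rw [Real.mul_rpow (by norm_num) (by linarith)]
      have : (5 : ℝ) ^ (1 / 4 : ℝ) ≤ 2 := by
        calc (5 : ℝ) ^ (1 / 4 : ℝ) ≤ (16 : ℝ) ^ (1 / 4 : ℝ) := by gcongr; norm_num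
          _ = 2 := by
            rw [show (16 : ℝ) = 2 ^ (4 : ℝ) by norm_num, ← Real.rpow_mul (by norm_num)]
            norm_num
      gcongr
    linarith
  have e3 : L ^ (1 / 2 : ℝ) * (L ^ (1 / 4 : ℝ) * L ^ (1 / 4 : ℝ)) = L := by
    rw [← Real.rpow_add (by linarith), ← Real.rpow_add (by linarith)]
    norm_num
  have e4 : L ^ (1 / 2 : ℝ) * Real.log (5 * L) * Real.log L ≤ 32 * L := by
    calc L ^ (1 / 2 : ℝ) * Real.log (5 * L) * Real.log L
        ≤ L ^ (1 / 2 : ℝ) * (8 * L ^ (1 / 4 : ℝ)) * (4 * L ^ (1 / 4 : ℝ)) := by gcongr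
      _ = 32 * (L ^ (1 / 2 : ℝ) * (L ^ (1 / 4 : ℝ) * L ^ (1 / 4 : ℝ))) := by ring
      _ = _ := by rw [e3]
  have e5 : Real.log 2 / (1 / 2 * Real.log L) * Real.log m * Real.log L =
      2 * Real.log 2 * Real.log m := by
    field_simp
  rw [e5]
  nlinarith

theorem Int.card_le_mul_of_dvd_det (D R n : ℤ) (hD : 0 < D) (hn : 0 < n) (hnR : n ≤ R)
    (w : ℤ × ℤ) (f : ℤ × ℤ → ℤ) (hf : f = Prod.fst ∨ f = Prod.snd) (hfw : |f w| = n)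
    (hw1 : |w.1| ≤ n) (hw2 : |w.2| ≤ n) (S : Finset (ℤ × ℤ))
    (hdet : ∀ P ∈ S, D ∣ w.1 * P.2 - w.2 * P.1)
    (hS : ∀ P ∈ S, |P.1| ≤ R ∧ |P.2| ≤ R)
    (hmin : ∀ P ∈ S, ∀ Q ∈ S, |P.1 - Q.1| < n → |P.2 - Q.2| < n → P = Q) :
    (S.card : ℝ) ≤ 16 * (R : ℝ) ^ 2 / D + 4 * R / n := by
  set J := 2 * n * R / D with hJ
  set r := R / n with hr
  have hR : 0 < R := by linarith
  have hJ0 : 0 ≤ J := Int.ediv_nonneg (by positivity) hD.le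
  have hr0 : 0 ≤ r := Int.ediv_nonneg hR.le hn.le
  have hcard : S.card ≤ (Finset.Icc (-J) J ×ˢ Finset.Icc (-r - 1) r).card := by
    apply Finset.card_le_card_of_injOn
      (fun P => ((w.1 * P.2 - w.2 * P.1) / D, f P / n))
    · intro P hP
      obtain ⟨k, hk⟩ := hdet P hP
      obtain ⟨h1, h2⟩ := hS P hP
      have hfP : |f P| ≤ R := by rcases hf with rfl | rfl <;> assumption
      have hb : |D * k| ≤ 2 * n * R := by
        rw [← hk]
        calc |w.1 * P.2 - w.2 * P.1| ≤ |w.1 * P.2| + |w.2 * P.1| := abs_sub _ _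
          _ = |w.1| * |P.2| + |w.2| * |P.1| := by rw [abs_mul, abs_mul]
          _ ≤ n * R + n * R := by gcongr
          _ = _ := by ring
      rw [abs_le] at hb hfP
      simp only [Finset.coe_product, Finset.coe_Icc, Set.mem_prod, Set.mem_Icc]
      rw [hk, Int.mul_ediv_cancel_left _ hD.ne']
      refine ⟨⟨?_, ?_⟩, ?_, ?_⟩
      · have : -k ≤ J := (Int.le_ediv_iff_mul_le hD).2 (by linarith)
        linarith
      · exact (Int.le_ediv_iff_mul_le hD).2 (by linarith)
      · have := Int.lt_ediv_add_one_mul_self R hn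
        exact (Int.le_ediv_iff_mul_le hn).2 (by nlinarith)
      · exact Int.ediv_le_ediv hn hfP.2
    · intro P hP Q hQ hPQ
      simp only [Prod.mk.injEq] at hPQ
      obtain ⟨hd, hq⟩ := hPQ
      obtain ⟨k, hk⟩ := hdet P hP
      obtain ⟨l, hl⟩ := hdet Q hQ
      rw [hk, hl, Int.mul_ediv_cancel_left _ hD.ne', Int.mul_ediv_cancel_left _ hD.ne'] at hd
      have hz : w.1 * (P.2 - Q.2) = w.2 * (P.1 - Q.1) := by
        rw [hd] at hk; linarith
      have hlt : |f P - f Q| < n := by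
        have a1 := Int.emod_add_mul_ediv (f P) n
        have a2 := Int.emod_add_mul_ediv (f Q) n
        have b1 := Int.emod_nonneg (f P) hn.ne'
        have b2 := Int.emod_nonneg (f Q) hn.ne'
        have c1 := Int.emod_lt_of_pos (f P) hn
        have c2 := Int.emod_lt_of_pos (f Q) hn
        rw [hq] at a1
        rw [abs_lt]; constructor <;> linarith
      have habs : |w.1| * |P.2 - Q.2| = |w.2| * |P.1 - Q.1| := by
        rw [← abs_mul, ← abs_mul, hz]
      rcases hf with rfl | rfl
      · refine hmin P hP Q hQ hlt (lt_of_le_of_lt ?_ hlt)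
        refine le_of_mul_le_mul_left (a := n) ?_ hn
        rw [hfw] at habs
        rw [habs]
        gcongr
      · refine hmin P hP Q hQ (lt_of_le_of_lt ?_ hlt) hlt
        refine le_of_mul_le_mul_left (a := n) ?_ hn
        rw [hfw] at habs
        rw [← habs]
        gcongr
  rw [Finset.card_product, Int.card_Icc, Int.card_Icc] at hcard
  have hcardZ : (S.card : ℤ) ≤ (2 * J + 1) * (2 * r + 2) := by
    have : (S.card : ℤ) ≤ ((J + 1 - -J).toNat * (r + 1 - (-r - 1)).toNat : ℕ) := by
      exact_mod_cast hcard
    rw [Nat.cast_mul, Int.toNat_of_nonneg (by linarith), Int.toNat_of_nonneg (by linarith)] at this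
    linarith
  have hcardR : (S.card : ℝ) ≤ (2 * J + 1) * (2 * r + 2) := by exact_mod_cast hcardZ
  have hDR : (0 : ℝ) < D := by exact_mod_cast hD
  have hnpos : (0 : ℝ) < n := by exact_mod_cast hn
  have hRR : (0 : ℝ) < R := by exact_mod_cast hR
  have hJR : (J : ℝ) ≤ 2 * n * R / D := by
    rw [le_div_iff₀ hDR]; exact_mod_cast Int.ediv_mul_le _ hD.ne'
  have hrR : (r : ℝ) ≤ R / n := by
    rw [le_div_iff₀ hnpos]; exact_mod_cast Int.ediv_mul_le _ hn.ne'
  have h1R : 1 ≤ (R : ℝ) / n := by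
    rw [le_div_iff₀ hnpos, one_mul]; exact_mod_cast hnR
  have hJ0R : (0 : ℝ) ≤ J := by exact_mod_cast hJ0
  calc (S.card : ℝ) ≤ (2 * J + 1) * (2 * r + 2) := hcardR
    _ ≤ (2 * (2 * n * R / D) + 1) * (4 * (R / n)) := by gcongr; linarith
    _ = _ := by field_simp; ring

theorem AddSubgroup.exists_card_le_of_dvd_det (L : AddSubgroup (ℤ × ℤ)) (D R : ℤ) (hD : 0 < D)
    (hdet : ∀ P ∈ L, ∀ Q ∈ L, D ∣ P.1 * Q.2 - P.2 * Q.1) (S : Finset (ℤ × ℤ))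
    (hS : ∀ P ∈ S, P ∈ L ∧ |P.1| ≤ R ∧ |P.2| ≤ R) (hS1 : 1 < S.card) :
    ∃ w ∈ L, w ≠ 0 ∧ ∃ n : ℤ, 0 < n ∧ |w.1| ≤ n ∧ |w.2| ≤ n ∧
      (S.card : ℝ) ≤ 16 * (R : ℝ) ^ 2 / D + 4 * R / n := by
  classical
  obtain ⟨P₀, hP₀, hP₀0⟩ := Finset.exists_mem_ne hS1 0
  have hex : ∃ k : ℕ, ∃ P ∈ L, P ≠ 0 ∧ max |P.1| |P.2| = k :=
    ⟨(max |P₀.1| |P₀.2|).toNat, P₀, (hS P₀ hP₀).1, hP₀0,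
      (Int.toNat_of_nonneg (le_max_of_le_left (abs_nonneg _))).symm⟩
  obtain ⟨w, hw, hw0, hwn⟩ := Nat.find_spec hex
  set n := Nat.find hex with hndef
  have hmin : ∀ P ∈ L, P ≠ 0 → (n : ℤ) ≤ max |P.1| |P.2| := by
    intro P hP hP0
    have hnn : 0 ≤ max |P.1| |P.2| := le_max_of_le_left (abs_nonneg _)
    have : n ≤ (max |P.1| |P.2|).toNat :=
      Nat.find_min' hex ⟨P, hP, hP0, (Int.toNat_of_nonneg hnn).symm⟩
    omega
  have h1 : |w.1| ≤ n := hwn ▸ le_max_left _ _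
  have h2 : |w.2| ≤ n := hwn ▸ le_max_right _ _
  have hn : (0 : ℤ) < n := by
    by_contra hcon
    apply hw0
    have a1 : |w.1| ≤ 0 := by linarith
    have a2 : |w.2| ≤ 0 := by linarith
    exact Prod.ext (abs_nonpos_iff.1 a1) (abs_nonpos_iff.1 a2)
  have hnR : (n : ℤ) ≤ R :=
    (hmin P₀ (hS P₀ hP₀).1 hP₀0).trans (max_le (hS P₀ hP₀).2.1 (hS P₀ hP₀).2.2)
  refine ⟨w, hw, hw0, n, hn, h1, h2, ?_⟩
  obtain ⟨f, hf, hfw⟩ : ∃ f : ℤ × ℤ → ℤ, (f = Prod.fst ∨ f = Prod.snd) ∧ |f w| = n := by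
    rcases max_choice |w.1| |w.2| with h | h
    · exact ⟨_, Or.inl rfl, by rw [← hwn, h]⟩
    · exact ⟨_, Or.inr rfl, by rw [← hwn, h]⟩
  refine Int.card_le_mul_of_dvd_det D R n hD hn hnR w f hf hfw h1 h2 S
    (fun P hP => hdet w hw P (hS P hP).1) (fun P hP => (hS P hP).2) ?_
  intro P hP Q hQ hlt1 hlt2
  by_contra hne
  have := hmin (P - Q) (L.sub_mem (hS P hP).1 (hS Q hQ).1) (sub_ne_zero.2 hne)
  have h3 : max |(P - Q).1| |(P - Q).2| < n := max_lt hlt1 hlt2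
  linarith

/-- The points of the box `[1, h]⁴`, grouped into two pairs. -/
noncomputable def boxQuadruples (h : ℕ) : Finset ((ℤ × ℤ) × (ℤ × ℤ)) :=
  (Finset.Icc 1 (h : ℤ) ×ˢ Finset.Icc 1 (h : ℤ)) ×ˢ (Finset.Icc 1 (h : ℤ) ×ˢ Finset.Icc 1 (h : ℤ))

theorem mem_boxQuadruples {h : ℕ} {q : (ℤ × ℤ) × (ℤ × ℤ)} : q ∈ boxQuadruples h ↔
    ((1 ≤ q.1.1 ∧ q.1.1 ≤ h) ∧ (1 ≤ q.1.2 ∧ q.1.2 ≤ h)) ∧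
      ((1 ≤ q.2.1 ∧ q.2.1 ≤ h) ∧ (1 ≤ q.2.2 ∧ q.2.2 ≤ h)) := by
  simp [boxQuadruples, Finset.mem_product]

theorem card_filter_sum_prod_le (h T : ℕ)
    (hT : ∀ m : ℕ, m ≠ 0 → m ≤ h ^ 2 → m.divisors.card ≤ T) (u v : ℤ) (hu : u ≠ 0) :
    ((boxQuadruples h).filter (fun q => q.1.1 + q.1.2 - (q.2.1 + q.2.2) = u ∧
      q.1.1 * q.1.2 - q.2.1 * q.2.2 = v)).card ≤ 2 * T * h + 2 * h := by
  classical
  set F := (boxQuadruples h).filter (fun q => q.1.1 + q.1.2 - (q.2.1 + q.2.2) = u ∧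
      q.1.1 * q.1.2 - q.2.1 * q.2.2 = v) with hF
  have hmul : ∀ q ∈ F, (q.1.1 - q.2.1) * (q.1.2 - q.2.1) = v - u * q.2.1 := by
    intro q hq
    obtain ⟨-, h1, h2⟩ := Finset.mem_filter.1 hq
    rw [← h1, ← h2]; ring
  have hcardI : (Finset.Icc 1 (h : ℤ)).card = h := by simp
  have hA : (F.filter (fun q => v - u * q.2.1 ≠ 0)).card ≤ 2 * T * h := by
    conv_rhs => rw [← hcardI]
    apply Finset.card_le_mul_card_image_of_maps_to (f := fun q => q.2.1)
    · intro q hq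
      have := mem_boxQuadruples.1 (Finset.mem_filter.1 (Finset.mem_filter.1 hq).1).1
      exact Finset.mem_Icc.2 this.2.1
    · intro y hy
      rcases (((F.filter (fun q => v - u * q.2.1 ≠ 0)).filter
        (fun q => q.2.1 = y))).eq_empty_or_nonempty with he | ⟨q₀, hq₀⟩
      · rw [he]; simp
      obtain ⟨hq₀, hy₀⟩ := Finset.mem_filter.1 hq₀
      obtain ⟨hq₀, hm₀⟩ := Finset.mem_filter.1 hq₀
      have hprod₀ := hmul q₀ hq₀
      rw [hy₀] at hm₀ hprod₀
      have hbound : (v - u * y).natAbs ≤ h ^ 2 := by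
        have hb := mem_boxQuadruples.1 (Finset.mem_filter.1 hq₀).1
        rw [← hprod₀, Int.natAbs_mul, sq]
        apply Nat.mul_le_mul <;> omega
      have hTm := hT _ (Int.natAbs_ne_zero.2 hm₀) hbound
      calc _ ≤ ((v - u * y).natAbs.divisors ×ˢ (Finset.univ : Finset Bool)).card := by
            apply Finset.card_le_card_of_injOn
              (fun q => ((q.1.1 - y).natAbs, decide (0 ≤ q.1.1 - y)))
            · intro q hq
              obtain ⟨hq, hqy⟩ := Finset.mem_filter.1 hq
              obtain ⟨hq, -⟩ := Finset.mem_filter.1 hq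
              have := hmul q hq
              rw [hqy] at this
              simp only [Finset.coe_product, Set.mem_prod, Finset.mem_coe, Nat.mem_divisors,
                Finset.mem_univ, and_true]
              refine ⟨?_, Int.natAbs_ne_zero.2 hm₀⟩
              rw [← this, Int.natAbs_mul]
              exact dvd_mul_right _ _
            · intro q hq q' hq' heq
              obtain ⟨hq, hqy⟩ := Finset.mem_filter.1 hq
              obtain ⟨hq, -⟩ := Finset.mem_filter.1 hq
              obtain ⟨hq', hqy'⟩ := Finset.mem_filter.1 hq'
              obtain ⟨hq', -⟩ := Finset.mem_filter.1 hq'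
              have e1 := hmul q hq
              have e2 := hmul q' hq'
              rw [hqy] at e1
              rw [hqy'] at e2
              simp only [Prod.mk.injEq, decide_eq_decide] at heq
              have h11 : q.1.1 = q'.1.1 := by omega
              have hne : q.1.1 - y ≠ 0 := by
                intro h0; rw [h0, zero_mul] at e1; exact hm₀ e1.symm
              have h12 : q.1.2 = q'.1.2 := by
                rw [← h11, ← e1] at e2
                have := mul_left_cancel₀ hne e2
                omega
              have s1 := (Finset.mem_filter.1 hq).2.1
              have s2 := (Finset.mem_filter.1 hq').2.1
              refine Prod.ext (Prod.ext h11 h12) (Prod.ext (hqy.trans hqy'.symm) ?_)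
              omega
        _ = (v - u * y).natAbs.divisors.card * 2 := by rw [Finset.card_product]; simp
        _ ≤ 2 * T := by omega
  have hdet : ∀ q ∈ F.filter (fun q => ¬ (v - u * q.2.1 ≠ 0)),
      ∀ q' ∈ F.filter (fun q => ¬ (v - u * q.2.1 ≠ 0)),
      q.1 = q'.1 → q = q' := by
    intro q hq q' hq' h1
    obtain ⟨hq, hz⟩ := Finset.mem_filter.1 hq
    obtain ⟨hq', hz'⟩ := Finset.mem_filter.1 hq'
    rw [not_not] at hz hz'
    have hy : q.2.1 = q'.2.1 := mul_left_cancel₀ hu (by linarith)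
    have s1 := (Finset.mem_filter.1 hq).2.1
    have s2 := (Finset.mem_filter.1 hq').2.1
    rw [h1] at s1
    exact Prod.ext h1 (Prod.ext hy (by omega))
  have hB : (F.filter (fun q => ¬ (v - u * q.2.1 ≠ 0))).card ≤ 2 * h := by
    have hy : ∀ q ∈ F.filter (fun q => ¬ (v - u * q.2.1 ≠ 0)),
        ∀ q' ∈ F.filter (fun q => ¬ (v - u * q.2.1 ≠ 0)), q.2.1 = q'.2.1 := by
      intro q hq q' hq'
      obtain ⟨-, hz⟩ := Finset.mem_filter.1 hq
      obtain ⟨-, hz'⟩ := Finset.mem_filter.1 hq'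
      rw [not_not] at hz hz'
      exact mul_left_cancel₀ hu (by linarith)
    have hor : ∀ q ∈ F.filter (fun q => ¬ (v - u * q.2.1 ≠ 0)),
        q.1.1 = q.2.1 ∨ q.1.2 = q.2.1 := by
      intro q hq
      obtain ⟨hq, hz⟩ := Finset.mem_filter.1 hq
      rw [not_not] at hz
      have := hmul q hq
      rw [hz] at this
      rcases mul_eq_zero.1 this with h | h <;> omega
    calc _ ≤ (Finset.Icc 1 (h : ℤ) ×ˢ (Finset.univ : Finset Bool)).card := by
          apply Finset.card_le_card_of_injOn
            (fun q => if q.1.1 = q.2.1 then (q.1.2, true) else (q.1.1, false))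
          · intro q hq
            have hb := mem_boxQuadruples.1 (Finset.mem_filter.1 (Finset.mem_filter.1 hq).1).1
            simp only [Finset.coe_product, Set.mem_prod, Finset.coe_Icc, Set.mem_Icc]
            split_ifs <;> simp [hb]
          · intro q hq q' hq' heq
            refine hdet q hq q' hq' ?_
            have a1 := hor q hq
            have a2 := hor q' hq'
            have a3 := hy q hq q' hq'
            simp only at heq
            split_ifs at heq with c1 c2 c2 <;> simp only [Prod.mk.injEq] at heq
            · exact Prod.ext (by omega) (by omega)
            · simp at heq
            · simp at heq
            · exact Prod.ext (by omega) (by omega)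
      _ = 2 * h := by rw [Finset.card_product, hcardI]; simp [mul_comm]
  rw [← Finset.card_filter_add_card_filter_not (s := F) (fun q => v - u * q.2.1 ≠ 0)]
  omega

/-- Solutions of `(x₁ + s)(x₂ + s) = (y₁ + s)(y₂ + s) ≠ 0` in `ZMod p` with all variables in
`[1, h]`. -/
noncomputable def shiftedProductSolutions (p h : ℕ) (s : ZMod p) : Finset ((ℤ × ℤ) × (ℤ × ℤ)) :=
  (boxQuadruples h).filter (fun q =>
    ((q.1.1 : ZMod p) + s) * ((q.1.2 : ZMod p) + s) =
      ((q.2.1 : ZMod p) + s) * ((q.2.2 : ZMod p) + s) ∧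
    ((q.1.1 : ZMod p) + s) * ((q.1.2 : ZMod p) + s) ≠ 0)

theorem card_shiftedProductSolutions_le (p h : ℕ) (hp : h ^ 2 ≤ p) (s : ZMod p) :
    (shiftedProductSolutions p h s).card ≤ 2 * h ^ 2 +
      ((shiftedProductSolutions p h s).filter
        (fun q => q.1.1 + q.1.2 ≠ q.2.1 + q.2.2)).card := by
  classical
  rw [← Finset.card_filter_add_card_filter_not (s := shiftedProductSolutions p h s)
    (fun q => q.1.1 + q.1.2 ≠ q.2.1 + q.2.2), add_comm]
  gcongr
  set I := Finset.Icc 1 (h : ℤ) with hI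
  have hcardI : I.card = h := by simp [hI]
  calc _ ≤ ((I ×ˢ I).image (fun x => (x, x)) ∪
        (I ×ˢ I).image (fun x => (x, x.swap))).card := by
        apply Finset.card_le_card
        intro q hq
        obtain ⟨hq, hsum⟩ := Finset.mem_filter.1 hq
        obtain ⟨hq, heq, -⟩ := Finset.mem_filter.1 hq
        have hb := mem_boxQuadruples.1 hq
        obtain ⟨⟨a, b⟩, ⟨c, d⟩⟩ := q
        simp only [not_not] at hsum heq hb
        have hprod : a * b = c * d := by
          have hz : ((a * b - c * d : ℤ) : ZMod p) = 0 := by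
            have hs : (a : ZMod p) + b = c + d := by
              exact_mod_cast congrArg (Int.cast (R := ZMod p)) hsum
            push_cast
            linear_combination heq - s * hs
          rw [ZMod.intCast_zmod_eq_zero_iff_dvd] at hz
          have hlt : |a * b - c * d| < p := by
            have h1 : a * b ≤ (h : ℤ) ^ 2 := by rw [sq]; gcongr <;> omega
            have h2 : c * d ≤ (h : ℤ) ^ 2 := by rw [sq]; gcongr <;> omega
            have h3 : 0 < a * b := mul_pos (by omega) (by omega)
            have h4 : 0 < c * d := mul_pos (by omega) (by omega)
            have h5 : (h : ℤ) ^ 2 ≤ p := by exact_mod_cast hp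
            rw [abs_lt]; constructor <;> linarith
          have := Int.eq_zero_of_abs_lt_dvd hz hlt
          linarith
        have hor : (a - c) * (a - d) = 0 := by
          linear_combination a * hsum - hprod
        simp only [Finset.mem_union, Finset.mem_image, Finset.mem_product]
        rcases mul_eq_zero.1 hor with h0 | h0
        · left
          refine ⟨(a, b), ⟨Finset.mem_Icc.2 hb.1.1, Finset.mem_Icc.2 hb.1.2⟩, ?_⟩
          simp only [Prod.mk.injEq, true_and]; omega
        · right
          refine ⟨(a, b), ⟨Finset.mem_Icc.2 hb.1.1, Finset.mem_Icc.2 hb.1.2⟩, ?_⟩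
          simp only [Prod.swap_prod_mk, Prod.mk.injEq, true_and]; omega
    _ ≤ (I ×ˢ I).card + (I ×ˢ I).card :=
        (Finset.card_union_le _ _).trans (add_le_add Finset.card_image_le Finset.card_image_le)
    _ = 2 * h ^ 2 := by rw [Finset.card_product, hcardI]; ring

theorem le_card_shiftedProductSolutions (p h : ℕ) (hpp : p.Prime) (hp : h ≤ p)
    (s : ZMod p) : 2 * (h : ℤ) ^ 2 - 5 * h ≤ (shiftedProductSolutions p h s).card := by
  have := Fact.mk hpp
  set I := Finset.Icc 1 (h : ℤ) with hI
  have hcardI : I.card = h := by simp [hI]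
  set G := I.filter (fun x : ℤ => (x : ZMod p) + s ≠ 0) with hG
  have hGle : G.card ≤ h := (Finset.card_filter_le _ _).trans hcardI.le
  have hGge : h ≤ G.card + 1 := by
    have h1 : G.card + (I.filter (fun x : ℤ => ¬ ((x : ZMod p) + s ≠ 0))).card = I.card := by
      convert Finset.card_filter_add_card_filter_not (s := I)
        (fun x : ℤ => (x : ZMod p) + s ≠ 0)
    have h2 : (I.filter (fun x : ℤ => ¬ ((x : ZMod p) + s ≠ 0))).card ≤ 1 := by
      rw [Finset.card_le_one]
      intro a ha b hb
      obtain ⟨ha, ha0⟩ := Finset.mem_filter.1 ha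
      obtain ⟨hb, hb0⟩ := Finset.mem_filter.1 hb
      rw [not_not] at ha0 hb0
      rw [hI, Finset.mem_Icc] at ha hb
      have hz : ((a - b : ℤ) : ZMod p) = 0 := by
        push_cast; linear_combination ha0 - hb0
      rw [ZMod.intCast_zmod_eq_zero_iff_dvd] at hz
      have := Int.eq_zero_of_abs_lt_dvd hz (by rw [abs_lt]; constructor <;> omega)
      linarith
    omega
  set D₁ := (G ×ˢ G).image (fun x => (x, x)) with hD₁
  set D₂ := (G ×ˢ G).image (fun x => (x, x.swap)) with hD₂
  have hc₁ : D₁.card = G.card * G.card := by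
    rw [hD₁, Finset.card_image_of_injective _ (fun a b hab => (Prod.mk.inj hab).1),
      Finset.card_product]
  have hc₂ : D₂.card = G.card * G.card := by
    rw [hD₂, Finset.card_image_of_injective _ (fun a b hab => (Prod.mk.inj hab).1),
      Finset.card_product]
  have hint : (D₁ ∩ D₂).card ≤ G.card := by
    calc _ ≤ (G.image (fun x => ((x, x), (x, x)))).card := by
          apply Finset.card_le_card
          intro q hq
          simp only [hD₁, hD₂, Finset.mem_inter, Finset.mem_image, Finset.mem_product] at hq
          obtain ⟨⟨x, hx, rfl⟩, ⟨y, hy, hyx⟩⟩ := hq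
          obtain ⟨h1, h2⟩ := Prod.mk.inj hyx
          subst h1
          refine Finset.mem_image.2 ⟨y.1, hy.1, ?_⟩
          have h3 : y.2 = y.1 := congrArg Prod.fst h2
          have h4 : y = (y.1, y.1) := Prod.ext rfl h3
          rw [← h4]
      _ ≤ _ := Finset.card_image_le
  have hsub : D₁ ∪ D₂ ⊆ shiftedProductSolutions p h s := by
    intro q hq
    simp only [hD₁, hD₂, Finset.mem_union, Finset.mem_image, Finset.mem_product] at hq
    rw [shiftedProductSolutions, Finset.mem_filter, mem_boxQuadruples]
    rcases hq with ⟨x, ⟨h1, h2⟩, rfl⟩ | ⟨x, ⟨h1, h2⟩, rfl⟩ <;>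
    · obtain ⟨h1, h1'⟩ := Finset.mem_filter.1 h1
      obtain ⟨h2, h2'⟩ := Finset.mem_filter.1 h2
      have b1 := Finset.mem_Icc.1 h1
      have b2 := Finset.mem_Icc.1 h2
      refine ⟨⟨⟨b1, b2⟩, by simp [b1, b2]⟩, ?_, mul_ne_zero h1' h2'⟩
      simp [mul_comm]
  have hle := Finset.card_le_card hsub
  have hui := Finset.card_union_add_card_inter D₁ D₂
  rw [hc₁, hc₂] at hui
  have hfin : 2 * (G.card * G.card) ≤ (shiftedProductSolutions p h s).card + h := by omega
  zify at hfin hGge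
  nlinarith

/-- The lattice of pairs `(h * u, v)` with `v + s * u = 0` in `ZMod p`. -/
def scaledCongruenceLattice (p h : ℕ) (s : ZMod p) : AddSubgroup (ℤ × ℤ) where
  carrier := {P | ∃ u : ℤ, P.1 = h * u ∧ (P.2 : ZMod p) + s * u = 0}
  zero_mem' := ⟨0, by simp⟩
  add_mem' := by
    rintro P Q ⟨u, h1, h2⟩ ⟨u', h1', h2'⟩
    refine ⟨u + u', by rw [Prod.fst_add, h1, h1']; ring, ?_⟩
    push_cast [Prod.snd_add]
    linear_combination h2 + h2'
  neg_mem' := by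
    rintro P ⟨u, h1, h2⟩
    refine ⟨-u, by rw [Prod.fst_neg, h1]; ring, ?_⟩
    push_cast [Prod.snd_neg]
    linear_combination -h2

theorem mem_scaledCongruenceLattice {p h : ℕ} {s : ZMod p} {P : ℤ × ℤ} :
    P ∈ scaledCongruenceLattice p h s ↔
      ∃ u : ℤ, P.1 = h * u ∧ (P.2 : ZMod p) + s * u = 0 := Iff.rfl

theorem scaledCongruenceLattice_dvd_det {p h : ℕ} {s : ZMod p} {P Q : ℤ × ℤ}
    (hP : P ∈ scaledCongruenceLattice p h s) (hQ : Q ∈ scaledCongruenceLattice p h s) :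
    (h * p : ℤ) ∣ P.1 * Q.2 - P.2 * Q.1 := by
  obtain ⟨u, h1, h2⟩ := hP
  obtain ⟨u', h1', h2'⟩ := hQ
  rw [h1, h1', show (h : ℤ) * u * Q.2 - P.2 * (h * u') = h * (u * Q.2 - P.2 * u') by ring]
  apply mul_dvd_mul_left
  rw [← ZMod.intCast_zmod_eq_zero_iff_dvd]
  push_cast
  linear_combination u * h2' - u' * h2

theorem card_offDiag_le_or_exists_small (p h T : ℕ) (hp : 0 < p) (hh : 0 < h)
    (hT : ∀ m : ℕ, m ≠ 0 → m ≤ h ^ 2 → m.divisors.card ≤ T) (s : ZMod p) (H : ℝ) (hH : 1 ≤ H)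
    (hHp : (h : ℝ) ^ 3 / p ≤ H) :
    (((shiftedProductSolutions p h s).filter
        (fun q => q.1.1 + q.1.2 ≠ q.2.1 + q.2.2)).card : ℝ) ≤ (2 * T * h + 2 * h) * (72 * H) ∨
    ∃ u v : ℤ, (u ≠ 0 ∨ v ≠ 0) ∧ h * |(u : ℝ)| ≤ h ^ 2 / H ∧ |(v : ℝ)| ≤ h ^ 2 / H ∧
      (v : ZMod p) + s * u = 0 := by
  classical
  set N := (shiftedProductSolutions p h s).filter
        (fun q => q.1.1 + q.1.2 ≠ q.2.1 + q.2.2) with hN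
  set B := Finset.Icc (-(2 * h ^ 2 : ℤ)) (2 * h ^ 2) with hB
  set S := (B ×ˢ B).filter (· ∈ scaledCongruenceLattice p h s) with hS
  have hhZ : (0 : ℤ) < h := by exact_mod_cast hh
  have hNS : N.card ≤ (2 * T * h + 2 * h) * S.card := by
    apply Finset.card_le_mul_card_image_of_maps_to
      (f := fun q : (ℤ × ℤ) × (ℤ × ℤ) =>
        ((h : ℤ) * (q.1.1 + q.1.2 - (q.2.1 + q.2.2)), q.1.1 * q.1.2 - q.2.1 * q.2.2))
    · intro q hq
      obtain ⟨hq, -⟩ := Finset.mem_filter.1 hq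
      obtain ⟨hq, heq, -⟩ := Finset.mem_filter.1 hq
      have hb := mem_boxQuadruples.1 hq
      have h1 : q.1.1 * q.1.2 ≤ (h : ℤ) ^ 2 := by rw [sq]; gcongr <;> omega
      have h2 : q.2.1 * q.2.2 ≤ (h : ℤ) ^ 2 := by rw [sq]; gcongr <;> omega
      have h3 : 0 < q.1.1 * q.1.2 := mul_pos (by omega) (by omega)
      have h4 : 0 < q.2.1 * q.2.2 := mul_pos (by omega) (by omega)
      rw [hS, Finset.mem_filter, Finset.mem_product, hB, Finset.mem_Icc, Finset.mem_Icc]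
      refine ⟨⟨⟨?_, ?_⟩, ?_, ?_⟩, q.1.1 + q.1.2 - (q.2.1 + q.2.2), rfl, ?_⟩
      · nlinarith
      · nlinarith
      · dsimp only; linarith
      · dsimp only; linarith
      · push_cast
        linear_combination heq
    · intro b hb
      rcases (N.filter (fun q => ((h : ℤ) * (q.1.1 + q.1.2 - (q.2.1 + q.2.2)),
        q.1.1 * q.1.2 - q.2.1 * q.2.2) = b)).eq_empty_or_nonempty with he | ⟨q₀, hq₀⟩
      · rw [he]; simp
      obtain ⟨hqN, rfl⟩ := Finset.mem_filter.1 hq₀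
      obtain ⟨-, hne⟩ := Finset.mem_filter.1 hqN
      refine le_trans (Finset.card_le_card ?_)
        (card_filter_sum_prod_le h T hT (q₀.1.1 + q₀.1.2 - (q₀.2.1 + q₀.2.2))
          (q₀.1.1 * q₀.1.2 - q₀.2.1 * q₀.2.2) (sub_ne_zero.2 hne))
      intro q hq
      obtain ⟨hq, heq⟩ := Finset.mem_filter.1 hq
      obtain ⟨hq, -⟩ := Finset.mem_filter.1 hq
      obtain ⟨hq, -⟩ := Finset.mem_filter.1 hq
      obtain ⟨h1, h2⟩ := Prod.mk.inj heq
      exact Finset.mem_filter.2 ⟨hq, mul_left_cancel₀ hhZ.ne' h1, h2⟩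
  by_cases hcard : (S.card : ℝ) ≤ 72 * H
  · left
    calc (N.card : ℝ) ≤ (2 * T * h + 2 * h) * S.card := by exact_mod_cast hNS
      _ ≤ _ := by gcongr
  · right
    push Not at hcard
    have hS1 : 1 < S.card := by
      have : (1 : ℝ) < S.card := by linarith
      exact_mod_cast this
    have hpZ : (0 : ℤ) < p := by exact_mod_cast hp
    obtain ⟨w, hw, hw0, n, hn, hw1, hw2, hle⟩ :=
      (scaledCongruenceLattice p h s).exists_card_le_of_dvd_det (h * p) (2 * h ^ 2)
        (by positivity) (fun P hP Q hQ => scaledCongruenceLattice_dvd_det hP hQ) S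
        (by
          intro P hP
          obtain ⟨hP, hPL⟩ := Finset.mem_filter.1 hP
          obtain ⟨h1, h2⟩ := Finset.mem_product.1 hP
          exact ⟨hPL, abs_le.2 (Finset.mem_Icc.1 h1), abs_le.2 (Finset.mem_Icc.1 h2)⟩) hS1
    have hhR : (0 : ℝ) < h := by exact_mod_cast hh
    have hpR : (0 : ℝ) < p := by exact_mod_cast hp
    have hnR : (0 : ℝ) < n := by exact_mod_cast hn
    have hnle : (n : ℝ) ≤ h ^ 2 / H := by
      have e1 : 16 * ((2 * h ^ 2 : ℤ) : ℝ) ^ 2 / ((h * p : ℤ) : ℝ) = 64 * ((h : ℝ) ^ 3 / p) := by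
        push_cast; field_simp; ring
      have e2 : 4 * ((2 * h ^ 2 : ℤ) : ℝ) / n = 8 * ((h : ℝ) ^ 2 / n) := by
        push_cast; ring
      rw [e1, e2] at hle
      have : H ≤ (h : ℝ) ^ 2 / n := by linarith
      rw [le_div_iff₀ (by linarith)]
      rw [le_div_iff₀ hnR] at this
      linarith
    obtain ⟨u, hu1, hu2⟩ := hw
    refine ⟨u, w.2, ?_, ?_, ?_, hu2⟩
    · by_contra hcon
      push Not at hcon
      exact hw0 (Prod.ext (by rw [hu1, hcon.1]; simp) hcon.2)
    · refine le_trans ?_ hnle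
      rw [hu1, abs_mul, Nat.abs_cast] at hw1
      exact_mod_cast hw1
    · refine le_trans ?_ hnle
      exact_mod_cast hw2

theorem ncard_eq_card_shiftedProductSolutions (p h : ℕ) (s : ZMod p) :
    Set.ncard {xy : (Fin 2 → ℤ) × (Fin 2 → ℤ) |
            (∀ i, 1 ≤ xy.1 i ∧ xy.1 i ≤ (h : ℤ)) ∧
            (∀ i, 1 ≤ xy.2 i ∧ xy.2 i ≤ (h : ℤ)) ∧
            (∏ i, ((xy.1 i : ZMod p) + s)) = (∏ i, ((xy.2 i : ZMod p) + s)) ∧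
            (∏ i, ((xy.1 i : ZMod p) + s)) ≠ 0} = (shiftedProductSolutions p h s).card := by
  rw [← Set.ncard_coe_finset]
  refine Set.ncard_congr (fun xy _ => ((xy.1 0, xy.1 1), (xy.2 0, xy.2 1))) ?_ ?_ ?_
  · rintro xy ⟨h1, h2, h3, h4⟩
    rw [Fin.prod_univ_two, Fin.prod_univ_two] at h3
    rw [Fin.prod_univ_two] at h4
    rw [Finset.mem_coe, shiftedProductSolutions, Finset.mem_filter, mem_boxQuadruples]
    exact ⟨⟨⟨h1 0, h1 1⟩, h2 0, h2 1⟩, h3, h4⟩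
  · rintro ⟨x, y⟩ ⟨x', y'⟩ - - heq
    simp only [Prod.mk.injEq] at heq
    refine Prod.ext ?_ ?_ <;> funext i <;> fin_cases i <;> simp [heq]
  · rintro ⟨⟨a, b⟩, ⟨c, d⟩⟩ hq
    rw [Finset.mem_coe, shiftedProductSolutions, Finset.mem_filter, mem_boxQuadruples] at hq
    refine ⟨(![a, b], ![c, d]), ⟨?_, ?_, ?_, ?_⟩, by simp⟩
    · intro i; fin_cases i <;> simp [hq.1.1]
    · intro i; fin_cases i <;> simp [hq.1.2]
    · simpa using hq.2.1
    · simpa using hq.2.2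

theorem Int.card_Icc_neg_floor_le {x : ℝ} (hx : 1 ≤ x) :
    ((Finset.Icc (-⌊x⌋) ⌊x⌋).card : ℝ) ≤ 3 * x := by
  have h0 : 0 ≤ ⌊x⌋ := Int.floor_nonneg.2 (by linarith)
  have h1 : (((Finset.Icc (-⌊x⌋) ⌊x⌋).card : ℤ) : ℝ) = 2 * ⌊x⌋ + 1 := by
    rw [Int.card_Icc, Int.toNat_of_nonneg (by linarith)]
    push_cast; ring
  rw [Int.cast_natCast] at h1
  rw [h1]
  linarith [Int.floor_le x]

theorem Int.mem_Icc_neg_floor {x : ℝ} {u : ℤ} (hu : |(u : ℝ)| ≤ x) :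
    u ∈ Finset.Icc (-⌊x⌋) ⌊x⌋ := by
  rw [Finset.mem_Icc, neg_le, Int.le_floor, Int.le_floor]
  push_cast
  exact ⟨by linarith [neg_abs_le (u : ℝ)], (le_abs_self _).trans hu⟩


/-- For fixed `0 < ε < 2` there are `C₁, C₂ > 0` such that for every prime `p` and
every integer `3 ≤ h ≤ p^{1/(2+ε/2)}`, the number of `s ∈ 𝔽_p` with
`|K₂(p,h,s) − 2h²| > h^{2−ε/2} exp(C₁ log h / log log h)` is at most `C₂·h^{1+ε}`. -/
theorem stmt6 (ε : ℝ) (hε : 0 < ε) (hε2 : ε < 2) :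
    ∃ C₁ C₂ : ℝ, 0 < C₁ ∧ 0 < C₂ ∧ ∀ p : ℕ, p.Prime → ∀ h : ℕ, 3 ≤ h →
      (h : ℝ) ≤ (p : ℝ) ^ ((1 : ℝ) / (2 + ε / 2)) →
      (Set.ncard {s : ZMod p |
        |(Set.ncard {xy : (Fin 2 → ℤ) × (Fin 2 → ℤ) |
            (∀ i, 1 ≤ xy.1 i ∧ xy.1 i ≤ (h : ℤ)) ∧
            (∀ i, 1 ≤ xy.2 i ∧ xy.2 i ≤ (h : ℤ)) ∧
            (∏ i, ((xy.1 i : ZMod p) + s)) = (∏ i, ((xy.2 i : ZMod p) + s)) ∧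
            (∏ i, ((xy.1 i : ZMod p) + s)) ≠ 0} : ℝ) - 2 * (h : ℝ) ^ 2| >
          (h : ℝ) ^ ((2 : ℝ) - ε / 2) *
            Real.exp (C₁ * Real.log h / Real.log (Real.log h))} : ℝ)
        ≤ C₂ * (h : ℝ) ^ ((1 : ℝ) + ε) := by
  obtain ⟨C, hC, hdiv⟩ := exists_card_divisors_le_exp
  refine ⟨C + 7, 9, by linarith, by norm_num, fun p hp h hh hhp => ?_⟩
  have := Fact.mk hp
  have hh3 : (3 : ℝ) ≤ h := by exact_mod_cast hh
  have hh0 : (0 : ℝ) < h := by linarith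
  have hh1 : (1 : ℝ) < h := by linarith
  have hp0 : (0 : ℝ) < p := by exact_mod_cast hp.pos
  have hpow : (h : ℝ) ^ (2 + ε / 2) ≤ p := by
    calc (h : ℝ) ^ (2 + ε / 2) ≤ ((p : ℝ) ^ ((1 : ℝ) / (2 + ε / 2))) ^ (2 + ε / 2) := by gcongr
      _ = p := by
        rw [← Real.rpow_mul hp0.le, one_div, inv_mul_cancel₀ (by linarith), Real.rpow_one]
  have hsqR : (h : ℝ) ^ 2 ≤ p := by
    refine le_trans ?_ hpow
    rw [← Real.rpow_natCast]
    exact Real.rpow_le_rpow_of_exponent_le hh1.le (by push_cast; linarith)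
  have hsq : h ^ 2 ≤ p := by exact_mod_cast hsqR
  have hlep : h ≤ p := le_trans (by nlinarith) hsq
  set H : ℝ := (h : ℝ) ^ (1 - ε / 2) with hH
  have hH1 : 1 ≤ H := Real.one_le_rpow hh1.le (by linarith)
  have hH0 : 0 < H := by linarith
  have hHh : (h : ℝ) * H = (h : ℝ) ^ (2 - ε / 2) := by
    rw [hH, ← Real.rpow_one_add' hh0.le (by linarith)]; ring_nf
  have hHp : (h : ℝ) ^ 3 / p ≤ H := by
    rw [div_le_iff₀ hp0]
    calc (h : ℝ) ^ 3 = H * (h : ℝ) ^ (2 + ε / 2) := by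
          rw [hH, ← Real.rpow_add hh0, ← Real.rpow_natCast]; norm_num
      _ ≤ H * p := by gcongr
  have hv : (h : ℝ) ^ 2 / H = (h : ℝ) ^ (1 + ε / 2) := by
    rw [hH, ← Real.rpow_natCast, ← Real.rpow_sub hh0]; congr 1; push_cast; ring
  have hu : (h : ℝ) / H = (h : ℝ) ^ (ε / 2) := by
    rw [hH]; nth_rw 1 [← Real.rpow_one (h : ℝ)]
    rw [← Real.rpow_sub hh0]; congr 1; ring
  set X : ℝ := Real.log h / Real.log (Real.log h) with hX
  have hX1 : 1 ≤ X := one_le_div_log (one_lt_log_natCast hh)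
  have hE : Real.exp ((C + 7) * Real.log h / Real.log (Real.log h)) =
      Real.exp (C * X) * Real.exp (7 * X) := by
    rw [← Real.exp_add, hX]; congr 1; ring
  have he7 : 288 ≤ Real.exp (7 * X) := by
    calc (288 : ℝ) ≤ (2.7 : ℝ) ^ 7 := by norm_num
      _ ≤ Real.exp 1 ^ 7 := by
        gcongr; linarith [Real.exp_one_gt_d9]
      _ = Real.exp (7 * 1) := by rw [← Real.exp_nat_mul]; norm_num
      _ ≤ _ := by gcongr
  have hE0 : 1 ≤ Real.exp (C * X) := Real.one_le_exp (by positivity)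
  have hT : ∀ m : ℕ, m ≠ 0 → m ≤ h ^ 2 → m.divisors.card ≤ ⌊Real.exp (C * X)⌋₊ := by
    intro m hm hmh
    refine Nat.le_floor ?_
    have := hdiv h hh m hm hmh
    rwa [mul_div_assoc] at this
  simp only [ncard_eq_card_shiftedProductSolutions]
  rw [hE]
  set f : ℤ × ℤ → ZMod p := fun x => -(x.2 : ZMod p) / x.1 with hf
  set W := Finset.Icc (-⌊(h : ℝ) ^ (ε / 2)⌋) ⌊(h : ℝ) ^ (ε / 2)⌋ ×ˢ
    Finset.Icc (-⌊(h : ℝ) ^ (1 + ε / 2)⌋) ⌊(h : ℝ) ^ (1 + ε / 2)⌋ with hW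
  have hWcard : (W.card : ℝ) ≤ 9 * (h : ℝ) ^ (1 + ε) := by
    rw [hW, Finset.card_product, Nat.cast_mul]
    calc _ ≤ (3 * (h : ℝ) ^ (ε / 2)) * (3 * (h : ℝ) ^ (1 + ε / 2)) := by
          gcongr
          · exact Int.card_Icc_neg_floor_le (Real.one_le_rpow hh1.le (by linarith))
          · exact Int.card_Icc_neg_floor_le (Real.one_le_rpow hh1.le (by linarith))
      _ = 9 * ((h : ℝ) ^ (ε / 2) * (h : ℝ) ^ (1 + ε / 2)) := by ring
      _ = _ := by rw [← Real.rpow_add hh0]; ring_nf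
  refine le_trans ?_ hWcard
  rw [Nat.cast_le, ← Set.ncard_coe_finset W]
  refine (Set.ncard_le_ncard ?_ (Set.toFinite _)).trans
    (Set.ncard_image_le (f := f) W.finite_toSet)
  intro s hs
  rw [Set.mem_ofPred_eq] at hs
  have hlow : 2 * (h : ℝ) ^ 2 - 5 * h ≤ (shiftedProductSolutions p h s).card := by
    exact_mod_cast le_card_shiftedProductSolutions p h hp hlep s
  have hup : ((shiftedProductSolutions p h s).card : ℝ) ≤ 2 * (h : ℝ) ^ 2 +
      ((shiftedProductSolutions p h s).filter
        (fun q => q.1.1 + q.1.2 ≠ q.2.1 + q.2.2)).card := by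
    exact_mod_cast card_shiftedProductSolutions_le p h hsq s
  rcases card_offDiag_le_or_exists_small p h _ hp.pos (by omega) hT s H hH1 hHp with
    hoff | ⟨u, v, huv, hub, hvb, hcong⟩
  · exfalso
    refine absurd hs (not_lt.2 ?_)
    rw [← hHh]
    have hfl : (⌊Real.exp (C * X)⌋₊ : ℝ) ≤ Real.exp (C * X) := Nat.floor_le (Real.exp_pos _).le
    have hbig : (h : ℝ) * H * (Real.exp (C * X) * 288) ≤
        h * H * (Real.exp (C * X) * Real.exp (7 * X)) := by gcongr
    have hhH : (h : ℝ) ≤ h * H := by nlinarith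
    rw [abs_le]
    constructor
    · have : 5 * (h : ℝ) ≤ h * H * (Real.exp (C * X) * 288) := by
        nlinarith [mul_le_mul hhH hE0 zero_le_one (by positivity)]
      linarith
    · have : (2 * (⌊Real.exp (C * X)⌋₊ : ℝ) * h + 2 * h) * (72 * H) ≤
          h * H * (Real.exp (C * X) * 288) := by
        calc _ ≤ (2 * Real.exp (C * X) * h + 2 * Real.exp (C * X) * h) * (72 * H) := by
              gcongr; linarith
          _ = _ := by ring
      linarith
  · rw [hv] at hvb
    have hub' : |(u : ℝ)| ≤ (h : ℝ) ^ (ε / 2) := by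
      rw [← hu, le_div_iff₀ hH0]
      rw [le_div_iff₀ hH0] at hub
      nlinarith
    refine ⟨(u, v), ?_, ?_⟩
    · rw [Finset.mem_coe, hW, Finset.mem_product]
      exact ⟨Int.mem_Icc_neg_floor hub', Int.mem_Icc_neg_floor hvb⟩
    · have hune : (u : ZMod p) ≠ 0 := by
        intro hu0
        have hv0 : (v : ZMod p) = 0 := by rw [hu0, mul_zero, add_zero] at hcong; exact hcong
        rw [ZMod.intCast_zmod_eq_zero_iff_dvd] at hu0 hv0
        have hvlt : |(v : ℝ)| < p := by
          refine hvb.trans_lt (lt_of_lt_of_le ?_ hpow)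
          exact Real.rpow_lt_rpow_of_exponent_lt hh1 (by linarith)
        have hult : |(u : ℝ)| < p := by
          refine hub'.trans_lt (lt_of_lt_of_le ?_ hpow)
          exact Real.rpow_lt_rpow_of_exponent_lt hh1 (by linarith)
        have h1 := Int.eq_zero_of_abs_lt_dvd hu0 (by exact_mod_cast hult)
        have h2 := Int.eq_zero_of_abs_lt_dvd hv0 (by exact_mod_cast hvlt)
        rcases huv with h | h <;> contradiction
      rw [hf]
      dsimp only
      rw [div_eq_iff hune]
      linear_combination -hcong
end

section
/- Fix a real ε with 0 < ε < 2. There exist constants C₁, C₂ > 0 (depending only on ε) such that for every prime p and every integer h with 3 ≤ h ≤ p^{1/(4+ε)}, the number of elements s ∈ F_p for which |K_3(p,h,s) − 6h³| > h^{3−ε/2}·exp(C₁·log h/log log h) is at most C₂·h^{1+ε}. -/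
/-- Reduction of an integer point modulo the lattice spanned by two independent vectors of a box. -/
lemma exists_reduction_mod_pair {X Y x₁ y₁ x₂ y₂ : ℤ} (hx₁ : |x₁| ≤ X) (hy₁ : |y₁| ≤ Y)
    (hx₂ : |x₂| ≤ X) (hy₂ : |y₂| ≤ Y) (hΔ : x₁ * y₂ - x₂ * y₁ ≠ 0) (z : ℤ × ℤ) :
    ∃ m n : ℤ, |z.1 - m * x₁ - n * x₂| ≤ 2 * X ∧ |z.2 - m * y₁ - n * y₂| ≤ 2 * Y := by
  obtain ⟨a, b⟩ := z
  set Δ := x₁ * y₂ - x₂ * y₁ with hΔdef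
  set e := a * y₂ - b * x₂ with he
  set f := x₁ * b - y₁ * a with hf
  have key : ∀ {B s t g : ℤ}, |s| ≤ B → |t| ≤ B →
      Δ * g = (e % Δ) * s + (f % Δ) * t → |g| ≤ 2 * B := by
    intro B s t g hs ht hg
    have h1 : |e % Δ| ≤ |Δ| := by
      rw [abs_of_nonneg (Int.emod_nonneg _ hΔ)]; exact (Int.emod_lt_abs _ hΔ).le
    have h2 : |f % Δ| ≤ |Δ| := by
      rw [abs_of_nonneg (Int.emod_nonneg _ hΔ)]; exact (Int.emod_lt_abs _ hΔ).le
    have hpos : 0 < |Δ| := abs_pos.mpr hΔ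
    have : |Δ| * |g| ≤ |Δ| * (2 * B) := by
      rw [← abs_mul, hg]
      calc _ ≤ |e % Δ * s| + |f % Δ * t| := abs_add_le _ _
        _ = |e % Δ| * |s| + |f % Δ| * |t| := by rw [abs_mul, abs_mul]
        _ ≤ |Δ| * B + |Δ| * B := by gcongr
        _ = _ := by ring
    exact le_of_mul_le_mul_left this hpos
  have he' := Int.emod_add_mul_ediv e Δ
  have hyf := Int.emod_add_mul_ediv f Δ
  refine ⟨e / Δ, f / Δ, key hx₁ hx₂ ?_, key hy₁ hy₂ ?_⟩
  · have : Δ * a = e * x₁ + f * x₂ := by simp only [hΔdef, he, hf]; ring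
    linear_combination this - x₁ * he' - x₂ * hyf
  · have : Δ * b = e * y₁ + f * y₂ := by simp only [hΔdef, he, hf]; ring
    linear_combination this - (y₁ * he' + y₂ * hyf)

/-- A box containing two independent points of the lattice `α x + y ≡ 0 (mod p)` contains
at most `49 X Y / p` points of it. -/
lemma card_mul_le_of_independent {p : ℕ} [Fact p.Prime] (α : ZMod p) {X Y : ℤ} (hX : 1 ≤ X)
    (hY : 1 ≤ Y) (S : Finset (ℤ × ℤ))
    (hS : ∀ w ∈ S, |w.1| ≤ X ∧ |w.2| ≤ Y ∧ α * (w.1 : ZMod p) + (w.2 : ZMod p) = 0)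
    {w₁ w₂ : ℤ × ℤ} (hw₁ : w₁ ∈ S) (hw₂ : w₂ ∈ S) (hΔ : w₁.1 * w₂.2 - w₂.1 * w₁.2 ≠ 0) :
    (p : ℤ) * S.card ≤ 49 * X * Y := by
  classical
  obtain ⟨a₁, b₁, c₁⟩ := hS _ hw₁
  obtain ⟨a₂, b₂, c₂⟩ := hS _ hw₂
  have hrep : ∀ r : ZMod p, ∃ z : ℤ × ℤ, |z.1| ≤ 2 * X ∧ |z.2| ≤ 2 * Y ∧
      α * (z.1 : ZMod p) + (z.2 : ZMod p) = r := by
    intro r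
    obtain ⟨m, n, hm, hn⟩ := exists_reduction_mod_pair a₁ b₁ a₂ b₂ hΔ (0, (r.val : ℤ))
    refine ⟨(0 - m * w₁.1 - n * w₂.1, (r.val : ℤ) - m * w₁.2 - n * w₂.2), hm, hn, ?_⟩
    push_cast
    rw [ZMod.natCast_zmod_val]
    linear_combination -(m : ZMod p) * c₁ - (n : ZMod p) * c₂
  choose z hz1 hz2 hz3 using hrep
  set f : ZMod p × ℤ × ℤ → ℤ × ℤ := fun q => z q.1 + q.2 with hf
  have hmaps : ∀ q ∈ (Finset.univ : Finset (ZMod p)) ×ˢ S,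
      f q ∈ Finset.Icc (-(3 * X)) (3 * X) ×ˢ Finset.Icc (-(3 * Y)) (3 * Y) := by
    rintro ⟨r, w⟩ hw
    obtain ⟨h1, h2, -⟩ := hS w (Finset.mem_product.mp hw).2
    have h3 := abs_le.mp (hz1 r)
    have h4 := abs_le.mp (hz2 r)
    rw [abs_le] at h1 h2
    simp only [hf, Finset.mem_product, Finset.mem_Icc, Prod.fst_add, Prod.snd_add]
    refine ⟨⟨?_, ?_⟩, ?_, ?_⟩ <;> linarith
  have hinj : ∀ q ∈ (Finset.univ : Finset (ZMod p)) ×ˢ S,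
      ∀ q' ∈ (Finset.univ : Finset (ZMod p)) ×ˢ S, f q = f q' → q = q' := by
    rintro ⟨r, w⟩ hw ⟨r', w'⟩ hw' heq
    have hw := (Finset.mem_product.mp hw).2
    have hw' := (Finset.mem_product.mp hw').2
    have e1 : (z r).1 + w.1 = (z r').1 + w'.1 := congrArg Prod.fst heq
    have e2 : (z r).2 + w.2 = (z r').2 + w'.2 := congrArg Prod.snd heq
    have e1' := congrArg (Int.cast : ℤ → ZMod p) e1
    have e2' := congrArg (Int.cast : ℤ → ZMod p) e2
    push_cast at e1' e2'
    have hr : r = r' := by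
      linear_combination -hz3 r + hz3 r' - (hS w hw).2.2 + (hS w' hw').2.2 + α * e1' + e2'
    subst hr
    have : w = w' := by
      ext <;> linarith
    rw [this]
  have hcard := Finset.card_le_card_of_injOn f hmaps hinj
  rw [Finset.card_product, Finset.card_product, Finset.card_univ, ZMod.card, Int.card_Icc,
    Int.card_Icc] at hcard
  zify at hcard
  rw [Int.toNat_of_nonneg (by linarith), Int.toNat_of_nonneg (by linarith)] at hcard
  nlinarith

lemma card_mul_abs_le {X x : ℤ} (hX : 0 ≤ X) {S : Finset (ℤ × ℤ)} (k : ℤ × ℤ → ℤ)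
    (hk : Set.InjOn k S) (hkx : ∀ w ∈ S, |k w * x| ≤ X) (hx : |x| ≤ X) :
    (S.card : ℤ) * |x| ≤ 3 * X := by
  rcases eq_or_ne x 0 with rfl | hx0
  · simpa using hX
  have hpos : 0 < |x| := abs_pos.mpr hx0
  have hq : 0 ≤ X / |x| := Int.ediv_nonneg hX hpos.le
  have hcard := Finset.card_le_card_of_injOn (s := S)
    (t := Finset.Icc (-(X / |x|)) (X / |x|)) k ?_ hk
  · rw [Int.card_Icc] at hcard
    zify at hcard
    rw [Int.toNat_of_nonneg (by linarith)] at hcard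
    have := Int.ediv_mul_le X hpos.ne'
    nlinarith
  · intro w hw
    have := hkx w hw
    rw [abs_mul] at this
    have h2 : |k w| ≤ X / |x| := (Int.le_ediv_iff_mul_le hpos).mpr this
    simpa [abs_le] using h2

/-- Many points of the lattice `α x + y ≡ 0 (mod p)` in a box are multiples of one
short primitive vector. -/
lemma exists_primitive_vector {p : ℕ} [Fact p.Prime] (α : ZMod p) {X Y : ℤ} (hX : 1 ≤ X)
    (hY : 1 ≤ Y) (hXp : X < p) (S : Finset (ℤ × ℤ))
    (hS : ∀ w ∈ S, |w.1| ≤ X ∧ |w.2| ≤ Y ∧ α * (w.1 : ZMod p) + (w.2 : ZMod p) = 0)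
    (hcard : 49 * X * Y < p * S.card) (hne : ∃ w ∈ S, w.1 ≠ 0) :
    ∃ x y : ℤ, IsCoprime x y ∧ x ≠ 0 ∧ α * (x : ZMod p) + (y : ZMod p) = 0 ∧
      S.card * |x| ≤ 3 * X ∧ S.card * |y| ≤ 3 * Y ∧ ∀ w ∈ S, ∃ k : ℤ, w = (k * x, k * y) := by
  obtain ⟨w, hw, hw0⟩ := hne
  obtain ⟨hwX, hwY, hwα⟩ := hS w hw
  have hg : 0 < Int.gcd w.1 w.2 := Int.gcd_pos_of_ne_zero_left _ hw0
  obtain ⟨x, y, hxy, hx, hy⟩ := Int.exists_gcd_one hg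
  have hxycop : IsCoprime x y := Int.isCoprime_iff_gcd_eq_one.mpr hxy
  set g : ℤ := (Int.gcd w.1 w.2 : ℤ) with hgdef
  have hg1 : 1 ≤ g := by omega
  have hx0 : x ≠ 0 := by rintro rfl; simp at hx; exact hw0 hx
  have hxX : |x| * g ≤ X := by rw [hx, abs_mul, abs_of_pos (by linarith : 0 < g)] at hwX; exact hwX
  have hyY : |y| * g ≤ Y := by rw [hy, abs_mul, abs_of_pos (by linarith : 0 < g)] at hwY; exact hwY
  have hx1 : 1 ≤ |x| := Int.one_le_abs hx0
  have hgp : (g : ZMod p) ≠ 0 := by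
    intro h
    rw [ZMod.intCast_zmod_eq_zero_iff_dvd] at h
    have := Int.le_of_dvd (by linarith) h
    nlinarith
  have hα : α * (x : ZMod p) + (y : ZMod p) = 0 := by
    rw [hx, hy] at hwα
    push_cast at hwα
    have : (g : ZMod p) * (α * (x : ZMod p) + (y : ZMod p)) = 0 := by linear_combination hwα
    exact (mul_eq_zero.mp this).resolve_left hgp
  have hmul : ∀ w' ∈ S, ∃ k : ℤ, w' = (k * x, k * y) := by
    intro w' hw'
    have hdet : w.1 * w'.2 - w'.1 * w.2 = 0 := by
      by_contra hΔ
      exact absurd (card_mul_le_of_independent α hX hY S hS hw hw' hΔ) (not_le.mpr hcard)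
    rw [hx, hy] at hdet
    have hdet' : x * w'.2 = w'.1 * y := by
      have : g * (x * w'.2 - w'.1 * y) = 0 := by linear_combination hdet
      rcases mul_eq_zero.mp this with h | h <;> linarith
    have hdvd : x ∣ w'.1 := hxycop.dvd_of_dvd_mul_right ⟨w'.2, hdet'.symm⟩
    obtain ⟨k, hk⟩ := hdvd
    refine ⟨k, Prod.ext (by rw [hk]; ring) ?_⟩
    apply mul_left_cancel₀ hx0
    rw [hdet', hk]; ring
  have hmul' : ∀ w', ∃ k : ℤ, w' ∈ S → w' = (k * x, k * y) := by
    intro w'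
    by_cases hw' : w' ∈ S
    · obtain ⟨k, hk⟩ := hmul w' hw'; exact ⟨k, fun _ => hk⟩
    · exact ⟨0, fun h => absurd h hw'⟩
  choose k hk using hmul'
  have hinj : Set.InjOn k S := by
    intro a ha b hb hab
    rw [hk a ha, hk b hb, hab]
  refine ⟨x, y, hxycop, hx0, hα, ?_, ?_, hmul⟩
  · refine card_mul_abs_le (by linarith) k hinj (fun w' hw' => ?_) (by nlinarith)
    have := (hS w' hw').1
    rwa [hk w' hw'] at this
  · refine card_mul_abs_le (by linarith) k hinj (fun w' hw' => ?_) (by nlinarith [abs_nonneg y])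
    have := (hS w' hw').2.1
    rwa [hk w' hw'] at this

open Real in
/-- The divisor function is at most `exp (O (log h / log log h))` on `[1, h ^ k]`. -/
lemma exists_card_divisors_le (k : ℕ) : ∃ c : ℝ, 0 < c ∧ ∀ h : ℕ, 3 ≤ h → ∀ n : ℕ, n ≠ 0 →
    n ≤ h ^ k → (n.divisors.card : ℝ) ≤ exp (c * (log h / log (log h))) := by
  refine ⟨82 * (k + 1), by positivity, fun h hh n hn hnk => ?_⟩
  have hlog1 : 1 < log h := by
    rw [Real.lt_log_iff_exp_lt (by positivity)]
    have : (3 : ℝ) ≤ h := by exact_mod_cast hh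
    linarith [Real.exp_one_lt_d9]
  set l := log h with hl
  set t := log l with ht
  have ht0 : 0 < t := Real.log_pos hlog1
  have hlt : l = exp t := (Real.exp_log (by linarith)).symm
  set y := exp (t / 2) with hy
  have hn1 : 1 ≤ n := Nat.one_le_iff_ne_zero.mpr hn
  have hn0 : (0 : ℝ) < n := by exact_mod_cast hn1
  have hlogn : log n ≤ k * l := by
    rw [hl, ← Real.log_pow]
    exact Real.log_le_log hn0 (by exact_mod_cast hnk)
  have hlogn0 : 0 ≤ log n := Real.log_natCast_nonneg n
  -- small primes
  set P := n.primeFactors.filter (fun q : ℕ => (q : ℝ) ≤ y) with hP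
  set Q := n.primeFactors.filter (fun q : ℕ => ¬ (q : ℝ) ≤ y) with hQ
  have hsplit : (n.divisors.card : ℝ) =
      (∏ q ∈ P, ((n.factorization q : ℝ) + 1)) * ∏ q ∈ Q, ((n.factorization q : ℝ) + 1) := by
    rw [Nat.card_divisors hn, hP, hQ, Finset.prod_filter_mul_prod_filter_not]
    push_cast
    rfl
  have hPcard : (P.card : ℝ) ≤ y := by
    have : P ⊆ Finset.Icc 1 ⌊y⌋₊ := by
      intro q hq
      rw [hP, Finset.mem_filter] at hq
      rw [Finset.mem_Icc]
      exact ⟨(Nat.prime_of_mem_primeFactors hq.1).one_le, Nat.le_floor hq.2⟩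
    have := Finset.card_le_card this
    rw [Nat.card_Icc, Nat.add_sub_cancel] at this
    calc (P.card : ℝ) ≤ ⌊y⌋₊ := by exact_mod_cast this
      _ ≤ y := Nat.floor_le (Real.exp_pos _).le
  have hfac : ∀ q ∈ n.primeFactors, (n.factorization q : ℝ) * log 2 ≤ log n := by
    intro q hq
    have hqp := Nat.prime_of_mem_primeFactors hq
    have h1 : 2 ^ n.factorization q ≤ n :=
      (Nat.pow_le_pow_left hqp.two_le _).trans (Nat.le_of_dvd (by omega) (Nat.ordProj_dvd n q))
    rw [← Real.log_pow]
    exact Real.log_le_log (by positivity) (by exact_mod_cast h1)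
  have hl2 : (1 / 2 : ℝ) < log 2 := by linarith [Real.log_two_gt_d9]
  have hsmall : ∏ q ∈ P, ((n.factorization q : ℝ) + 1) ≤ exp (y * ((2 * k + 1) + t)) := by
    have hb : ∀ q ∈ P, (n.factorization q : ℝ) + 1 ≤ exp ((2 * k + 1) + t) := by
      intro q hq
      have h1 := hfac q (Finset.mem_filter.mp hq).1
      have h2 : (n.factorization q : ℝ) ≤ 2 * k * l := by
        have : (0 : ℝ) ≤ n.factorization q := by positivity
        nlinarith
      rw [Real.exp_add, ← hlt]
      have h3 := Real.add_one_le_exp ((2 * k + 1 : ℝ))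
      nlinarith
    calc _ ≤ ∏ _q ∈ P, exp ((2 * k + 1) + t) :=
          Finset.prod_le_prod (fun _ _ => by positivity) hb
      _ = exp (P.card * ((2 * k + 1) + t)) := by rw [Finset.prod_const, ← Real.exp_nat_mul]
      _ ≤ _ := by gcongr
  have hlarge : ∏ q ∈ Q, ((n.factorization q : ℝ) + 1) ≤ exp (2 * k * (l / t)) := by
    have hsum : (∑ q ∈ Q, (n.factorization q : ℝ)) * (t / 2) ≤ log n := by
      have hlogn' : log n = ∑ q ∈ n.primeFactors, (n.factorization q : ℝ) * log q := by
        conv_lhs => rw [← Nat.prod_factorization_pow_eq_self hn]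
        rw [Finsupp.prod, Nat.support_factorization]
        push_cast
        rw [Real.log_prod]
        · exact Finset.sum_congr rfl fun q _ => by rw [Real.log_pow]
        · intro q hq
          have := (Nat.prime_of_mem_primeFactors hq).pos
          positivity
      rw [hlogn', Finset.sum_mul]
      calc _ ≤ ∑ q ∈ Q, (n.factorization q : ℝ) * log q := by
            refine Finset.sum_le_sum fun q hq => ?_
            have h1 := (Finset.mem_filter.mp hq).2
            have h2 : t / 2 ≤ log q := by
              rw [Real.le_log_iff_exp_le (by linarith [Real.exp_pos (t / 2)])]
              linarith
            gcongr
        _ ≤ _ := by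
            refine Finset.sum_le_sum_of_subset_of_nonneg (Finset.filter_subset _ _) ?_
            intro q _ _
            have := Real.log_natCast_nonneg q
            positivity
    calc _ ≤ ∏ q ∈ Q, exp (n.factorization q : ℝ) :=
          Finset.prod_le_prod (fun _ _ => by positivity) (fun q _ => Real.add_one_le_exp _)
      _ = exp (∑ q ∈ Q, (n.factorization q : ℝ)) := (Real.exp_sum _ _).symm
      _ ≤ _ := by
        gcongr
        rw [mul_div_assoc', le_div_iff₀ ht0]
        linarith
  have hyt : y * t ≤ 40 * (l / t) ∧ y ≤ 40 * (l / t) := by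
    have hl' : l = y * y := by rw [hlt, hy, ← Real.exp_add]; ring_nf
    have hy1 : 1 + t / 2 + (t / 2) ^ 2 / 2 ≤ y := by
      have := Real.quadratic_le_exp_of_nonneg (x := t / 2) (by positivity)
      linarith
    have hy0 : 0 < y := Real.exp_pos _
    constructor
    · rw [mul_div_assoc', le_div_iff₀ ht0, hl']
      nlinarith
    · rw [mul_div_assoc', le_div_iff₀ ht0, hl']
      nlinarith
  rw [hsplit]
  calc _ ≤ exp (y * ((2 * k + 1) + t)) * exp (2 * k * (l / t)) := by
        gcongr
    _ = exp (y * ((2 * k + 1) + t) + 2 * k * (l / t)) := (Real.exp_add _ _).symm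
    _ ≤ _ := by
      gcongr
      have : 0 < l / t := by positivity
      have hk : (0 : ℝ) ≤ k := by positivity
      nlinarith [mul_le_mul_of_nonneg_left hyt.2 hk]

lemma abs_combination_lt {h F n N Y a d u v P : ℤ} (hh : 1 ≤ h) (hn : 0 ≤ n) (hF : 0 < F)
    (hv : F * |v| ≤ 3 * (6 * h ^ 2)) (hu : F * |u| ≤ 3 * (2 * h ^ 3)) (ha : n * |a| ≤ 3 * (3 * h))
    (hd : n * |d| ≤ 3 * Y) (hY : F * Y ≤ 36 * h ^ 5) (hNF : N ≤ 7 * h * F) (hNF' : N ≤ F * n)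
    (hN : 0 ≤ N) (hP : 15876 * h ^ 8 < P * N ^ 2) : |a * u ^ 2 + d * v| < P := by
  have h1 : |a * u ^ 2 + d * v| ≤ |a| * |u| ^ 2 + |d| * |v| := by
    refine (abs_add_le _ _).trans ?_
    rw [abs_mul, abs_mul, abs_pow]
  have e1 : (F * |u|) ^ 2 ≤ (3 * (2 * h ^ 3)) ^ 2 :=
    pow_le_pow_left₀ (mul_nonneg hF.le (abs_nonneg u)) hu 2
  have e2 : (n * |a|) * (F * |u|) ^ 2 ≤ (3 * (3 * h)) * (3 * (2 * h ^ 3)) ^ 2 :=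
    mul_le_mul ha e1 (sq_nonneg _) (by linarith)
  have e3 : F * (n * |d|) ≤ 108 * h ^ 5 := by
    have := mul_le_mul_of_nonneg_left hd hF.le
    linarith
  have e4 : (F * (n * |d|)) * (F * |v|) ≤ (108 * h ^ 5) * (3 * (6 * h ^ 2)) :=
    mul_le_mul e3 hv (mul_nonneg hF.le (abs_nonneg v)) (by positivity)
  have h2 : (n * F ^ 2) * |a * u ^ 2 + d * v| ≤ 2268 * h ^ 7 := by
    have := mul_le_mul_of_nonneg_left h1 (by positivity : 0 ≤ n * F ^ 2)
    linarith
  have h3 : N ^ 2 ≤ 7 * h * (n * F ^ 2) := by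
    have := mul_le_mul hNF' hNF hN (by positivity)
    linarith
  have h4 : N ^ 2 * |a * u ^ 2 + d * v| < N ^ 2 * P := by
    have h5 := mul_le_mul_of_nonneg_right h3 (abs_nonneg (a * u ^ 2 + d * v))
    have h6 := mul_le_mul_of_nonneg_left h2 (by linarith : 0 ≤ 7 * h)
    linarith
  exact lt_of_mul_lt_mul_left h4 (sq_nonneg N)

set_option maxHeartbeats 1000000 in
/-- If many quadratic polynomials with small coefficients share the root `s` modulo `p`, then
they share a rational root which reduces to `s`. -/
lemma exists_common_rational_root {p : ℕ} [Fact p.Prime] (s : ZMod p) {h : ℤ} (hh : 1 ≤ h)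
    (hp2 : 18 * h ^ 2 < p) (hp3 : 2 * h ^ 3 < p) (Λ : Finset (ℤ × ℤ × ℤ))
    (hΛ : ∀ w ∈ Λ, |w.1| ≤ 3 * h ∧ |w.2.1| ≤ 3 * h ^ 2 ∧ |w.2.2| ≤ h ^ 3 ∧
      (w.1 : ZMod p) * s ^ 2 + (w.2.1 : ZMod p) * s + (w.2.2 : ZMod p) = 0)
    (hN : 7 * h < Λ.card) (hN1 : 5292 * h ^ 6 < p * Λ.card)
    (hN2 : 15876 * h ^ 8 < p * (Λ.card : ℤ) ^ 2) :
    ∃ u v : ℤ, IsCoprime u v ∧ (v : ZMod p) ≠ 0 ∧ (v : ZMod p) * s = u ∧ |v| ≤ 18 * h ^ 2 ∧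
      |u| ≤ 6 * h ^ 3 ∧ ∀ w ∈ Λ, w.1 * u ^ 2 + w.2.1 * u * v + w.2.2 * v ^ 2 = 0 := by
  classical
  have hh2 : 1 ≤ h ^ 2 := one_le_pow₀ hh
  have hh3 : 1 ≤ h ^ 3 := one_le_pow₀ hh
  have hp0 : (0 : ℤ) < p := by linarith
  set S := (Finset.Icc (-(6 * h ^ 2)) (6 * h ^ 2) ×ˢ Finset.Icc (-(2 * h ^ 3)) (2 * h ^ 3)).filter
    (fun w : ℤ × ℤ => s * (w.1 : ZMod p) + (w.2 : ZMod p) = 0) with hSdef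
  have hmemS : ∀ w : ℤ × ℤ, w ∈ S ↔
      |w.1| ≤ 6 * h ^ 2 ∧ |w.2| ≤ 2 * h ^ 3 ∧ s * (w.1 : ZMod p) + (w.2 : ZMod p) = 0 := by
    intro w
    simp only [hSdef, Finset.mem_filter, Finset.mem_product, Finset.mem_Icc, abs_le, and_assoc]
  have hfib : ∀ T : Finset (ℤ × ℤ × ℤ), T ⊆ Λ → (∀ w ∈ T, ∀ w' ∈ T, w.1 = w'.1) →
      T.card ≤ S.card := by
    intro T hT hconst
    rcases T.eq_empty_or_nonempty with rfl | ⟨w₀, hw₀⟩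
    · simp
    refine Finset.card_le_card_of_injOn (fun w : ℤ × ℤ × ℤ => w.2 - w₀.2) (fun w hw => ?_) ?_
    · obtain ⟨-, a2, a3, a4⟩ := hΛ w (hT hw)
      obtain ⟨-, b2, b3, b4⟩ := hΛ w₀ (hT hw₀)
      rw [hconst w hw w₀ hw₀] at a4
      simp only [Finset.mem_coe, hmemS, Prod.fst_sub, Prod.snd_sub]
      refine ⟨?_, ?_, ?_⟩
      · exact (abs_sub _ _).trans (by linarith)
      · exact (abs_sub _ _).trans (by linarith)
      · push_cast
        linear_combination a4 - b4
    · intro w hw w' hw' heq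
      have h2 : w.2 = w'.2 := sub_left_injective heq
      exact Prod.ext (hconst w hw w' hw') h2
  set F : ℤ := (S.card : ℤ) with hF
  set N : ℤ := (Λ.card : ℤ) with hNdef
  have hNF : N ≤ 7 * h * F := by
    have h1 := Finset.card_le_mul_card_image (f := fun w : ℤ × ℤ × ℤ => w.1) Λ S.card
      (fun a _ => hfib _ (Finset.filter_subset _ _) (fun w hw w' hw' => by
        rw [(Finset.mem_filter.mp hw).2, (Finset.mem_filter.mp hw').2]))
    have h2 : Λ.image (fun w : ℤ × ℤ × ℤ => w.1) ⊆ Finset.Icc (-(3 * h)) (3 * h) := by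
      intro a ha
      obtain ⟨w, hw, rfl⟩ := Finset.mem_image.mp ha
      exact Finset.mem_Icc.mpr (abs_le.mp (hΛ w hw).1)
    have h3 := Finset.card_le_card h2
    rw [Int.card_Icc] at h3
    zify at h1 h3
    rw [Int.toNat_of_nonneg (by linarith)] at h3
    have : 0 ≤ F := by positivity
    nlinarith
  have hF2 : 2 ≤ F := by
    by_contra hlt
    have : F ≤ 1 := by linarith
    nlinarith
  have hS0 : ∀ w ∈ S, w.1 = 0 → w.2 = 0 := by
    intro w hw h0
    obtain ⟨-, h2, h3⟩ := (hmemS w).mp hw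
    rw [h0] at h3
    simp only [Int.cast_zero, mul_zero, zero_add] at h3
    rw [ZMod.intCast_zmod_eq_zero_iff_dvd] at h3
    exact Int.eq_zero_of_abs_lt_dvd h3 (by linarith)
  have hSne : ∃ w ∈ S, w.1 ≠ 0 := by
    by_contra! hall
    have : S ⊆ {(0, 0)} := by
      intro w hw
      rw [Finset.mem_singleton]
      exact Prod.ext (hall w hw) (hS0 w hw (hall w hw))
    have := Finset.card_le_card this
    rw [Finset.card_singleton] at this
    omega
  have hpF : 49 * (6 * h ^ 2) * (2 * h ^ 3) < p * F := by
    have : 7 * h * (588 * h ^ 5) < 7 * h * (p * F) := by nlinarith [pow_pos (by linarith : 0 < h) 6]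
    have := lt_of_mul_lt_mul_left this (by linarith)
    linarith
  obtain ⟨v, y, hcop, hv0, hsv, hvF, hyF, hline⟩ := exists_primitive_vector s
    (X := 6 * h ^ 2) (Y := 2 * h ^ 3) (by linarith) (by linarith) (by linarith) S
    (fun w hw => (hmemS w).mp hw) hpF hSne
  have hvb : |v| ≤ 18 * h ^ 2 := by nlinarith [abs_nonneg v]
  have hvp : (v : ZMod p) ≠ 0 := by
    intro h0
    rw [ZMod.intCast_zmod_eq_zero_iff_dvd] at h0
    exact hv0 (Int.eq_zero_of_abs_lt_dvd h0 (by linarith))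
  obtain ⟨u, rfl⟩ : ∃ u, y = -u := ⟨-y, by ring⟩
  rw [abs_neg] at hyF
  have hub : |u| ≤ 6 * h ^ 3 := by nlinarith [abs_nonneg u]
  have hsu : (v : ZMod p) * s = u := by push_cast at hsv; linear_combination hsv
  refine ⟨u, v, (IsCoprime.neg_right_iff _ _).mp hcop |>.symm, hvp, hsu, hvb, hub, ?_⟩
  set g : ℤ × ℤ × ℤ → ℤ × ℤ := fun w => (w.1, w.2.1 * u + w.2.2 * v) with hg
  set S' := Λ.image g with hS'
  have hNF' : N ≤ F * S'.card := by
    have h1 := Finset.card_le_mul_card_image (f := g) Λ S.card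
      (fun a _ => hfib _ (Finset.filter_subset _ _) (fun w hw w' hw' => by
        have h1 := (Finset.mem_filter.mp hw).2
        have h2 := (Finset.mem_filter.mp hw').2
        exact congrArg (fun q : ℤ × ℤ => q.1) (h1.trans h2.symm)))
    rw [hNdef, hF]
    exact_mod_cast h1
  have hS'0 : ∀ w ∈ S', w.1 = 0 → w.2 = 0 := by
    intro w hw h0
    obtain ⟨q, hq, rfl⟩ := Finset.mem_image.mp hw
    obtain ⟨-, a2, a3, a4⟩ := hΛ q hq
    have hq0 : q.1 = 0 := h0
    rw [hq0] at a4
    obtain ⟨k, hk⟩ := hline q.2 ((hmemS _).mpr ⟨by linarith, by linarith, by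
      push_cast at a4; linear_combination a4⟩)
    simp only [hg, hk]
    ring
  suffices hS'line : ∀ w ∈ S', w.1 * u ^ 2 + w.2 * v = 0 by
    intro w hw
    have := hS'line _ (Finset.mem_image_of_mem g hw)
    simp only [hg] at this
    linear_combination this
  by_cases hS'ne : ∃ w ∈ S', w.1 ≠ 0
  swap
  · push Not at hS'ne
    intro w hw
    rw [hS'ne w hw, hS'0 w hw (hS'ne w hw)]
    ring
  set Y := 3 * h ^ 2 * |u| + h ^ 3 * |v| with hY
  have hv1 : 1 ≤ |v| := Int.one_le_abs hv0
  have hY1 : 1 ≤ Y := by nlinarith [abs_nonneg u]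
  have hYF : F * Y ≤ 36 * h ^ 5 := by
    rw [hY]
    nlinarith [mul_le_mul_of_nonneg_left hyF (by linarith : 0 ≤ 3 * h ^ 2),
      mul_le_mul_of_nonneg_left hvF (by linarith : 0 ≤ h ^ 3)]
  set n : ℤ := (S'.card : ℤ) with hn
  have hcard' : 49 * (3 * h) * Y < p * n := by
    have : F * (49 * (3 * h) * Y) < F * (p * n) := by
      calc F * (49 * (3 * h) * Y) = 147 * h * (F * Y) := by ring
        _ ≤ 147 * h * (36 * h ^ 5) := by gcongr
        _ = 5292 * h ^ 6 := by ring
        _ < p * N := hN1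
        _ ≤ p * (F * n) := by gcongr
        _ = _ := by ring
    exact lt_of_mul_lt_mul_left this (by linarith)
  obtain ⟨a, d, -, -, had, haN, hdN, hline'⟩ := exists_primitive_vector (s * (u : ZMod p))
    (X := 3 * h) (Y := Y) (by linarith) hY1 (by nlinarith) S' (fun w hw => by
      obtain ⟨q, hq, rfl⟩ := Finset.mem_image.mp hw
      obtain ⟨a1, a2, a3, a4⟩ := hΛ q hq
      refine ⟨a1, ?_, ?_⟩
      · calc |q.2.1 * u + q.2.2 * v| ≤ |q.2.1 * u| + |q.2.2 * v| := abs_add_le _ _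
          _ = |q.2.1| * |u| + |q.2.2| * |v| := by rw [abs_mul, abs_mul]
          _ ≤ Y := by rw [hY]; gcongr
      · apply mul_left_cancel₀ hvp
        simp only [hg]
        push_cast
        rw [← hsu]
        linear_combination (v : ZMod p) ^ 2 * a4) hcard' hS'ne
  have hval : a * u ^ 2 + d * v = 0 := by
    have hdvd : (p : ℤ) ∣ a * u ^ 2 + d * v := by
      rw [← ZMod.intCast_zmod_eq_zero_iff_dvd]
      push_cast
      linear_combination (v : ZMod p) * had - (a : ZMod p) * (u : ZMod p) * hsu
    refine Int.eq_zero_of_abs_lt_dvd hdvd ?_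
    exact abs_combination_lt hh (by positivity) (by linarith) hvF hyF haN hdN hYF hNF hNF'
      (by positivity) (by linarith)
  intro w hw
  obtain ⟨k, rfl⟩ := hline' w hw
  linear_combination k * hval

lemma card_le_of_prod_eq {ι : Type*} {D M : ℕ}
    (hD : ∀ n : ℕ, n ≠ 0 → n ≤ M → n.divisors.card ≤ D) {n : ℤ} (hn : n ≠ 0) (hnM : |n| ≤ M)
    (S : Finset ι) (g : ι → Fin 3 → ℤ) (hg : Set.InjOn g S) (hS : ∀ z ∈ S, ∏ i, g z i = n) :
    S.card ≤ (2 * D) ^ 2 := by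
  classical
  set E : Finset ℤ := n.natAbs.divisors.image (fun d : ℕ => (d : ℤ)) ∪
    n.natAbs.divisors.image (fun d : ℕ => -(d : ℤ)) with hE
  have hdiv := hD n.natAbs (Int.natAbs_ne_zero.mpr hn) (by zify; exact hnM)
  have hEcard : E.card ≤ 2 * D := by
    have h2 := Finset.card_image_le (s := n.natAbs.divisors) (f := fun d : ℕ => (d : ℤ))
    have h3 := Finset.card_image_le (s := n.natAbs.divisors) (f := fun d : ℕ => -(d : ℤ))
    refine (Finset.card_union_le _ _).trans ?_
    omega
  have hmem : ∀ d : ℤ, d ∣ n → d ∈ E := by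
    intro d hd
    have : d.natAbs ∈ n.natAbs.divisors :=
      Nat.mem_divisors.mpr ⟨Int.natAbs_dvd_natAbs.mpr hd, Int.natAbs_ne_zero.mpr hn⟩
    rw [hE, Finset.mem_union, Finset.mem_image, Finset.mem_image]
    rcases Int.natAbs_eq d with h | h
    · exact Or.inl ⟨_, this, h.symm⟩
    · exact Or.inr ⟨_, this, h.symm⟩
  have hcard := Finset.card_le_card_of_injOn (s := S) (t := E ×ˢ E)
    (fun z => (g z 0, g z 1)) (fun z hz => ?_) ?_
  · calc S.card ≤ (E ×ˢ E).card := hcard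
      _ = E.card * E.card := Finset.card_product _ _
      _ ≤ (2 * D) * (2 * D) := Nat.mul_le_mul hEcard hEcard
      _ = _ := (sq _).symm
  · have := hS z hz
    rw [Finset.mem_coe, Finset.mem_product]
    exact ⟨hmem _ (this ▸ Finset.dvd_prod_of_mem _ (Finset.mem_univ _)),
      hmem _ (this ▸ Finset.dvd_prod_of_mem _ (Finset.mem_univ _))⟩
  · intro z hz w hw hzw
    simp only [Prod.mk.injEq] at hzw
    have h1 := hS z hz
    have h2 := hS w hw
    rw [Fin.prod_univ_three] at h1 h2
    have h01 : g z 0 * g z 1 ≠ 0 := by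
      intro h; rw [h, zero_mul] at h1; exact hn h1.symm
    have h3 : g z 2 = g w 2 := by
      apply mul_left_cancel₀ h01
      rw [h1, hzw.1, hzw.2, h2]
    apply hg hz hw
    funext i
    fin_cases i
    · exact hzw.1
    · exact hzw.2
    · exact h3

/-- The linear form `x ↦ u + v x` applied to the three coordinates. -/
def affineMap (u v : ℤ) (x : Fin 3 → ℤ) : Fin 3 → ℤ := fun i => u + v * x i

lemma affineMap_injective (u : ℤ) {v : ℤ} (hv : v ≠ 0) : Function.Injective (affineMap u v) := by
  intro x y hxy
  funext i
  exact mul_left_cancel₀ hv (add_left_cancel (congrFun hxy i))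

lemma card_pairs_le_of_prod_eq {D M : ℕ}
    (hD : ∀ n : ℕ, n ≠ 0 → n ≤ M → n.divisors.card ≤ D) {n : ℤ} (hn : n ≠ 0) (hnM : |n| ≤ M)
    {t u v : ℤ} (hv : v ≠ 0) (m : (Fin 3 → ℤ) → ℤ) (S : Finset ((Fin 3 → ℤ) × (Fin 3 → ℤ)))
    (hS : ∀ q ∈ S, ∏ i, (q.1 i - t) = n ∧ ∏ i, (u + v * q.2 i) = m q.1 ∧ m q.1 ≠ 0 ∧
      |m q.1| ≤ M) :
    S.card ≤ (2 * D) ^ 4 := by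
  classical
  have h1 := Finset.card_le_mul_card_image (f := Prod.fst) S ((2 * D) ^ 2) (fun x hx => by
    obtain ⟨q₀, hq₀, rfl⟩ := Finset.mem_image.mp hx
    obtain ⟨-, -, hm0, hmM⟩ := hS q₀ hq₀
    refine card_le_of_prod_eq hD hm0 hmM _ (fun q => affineMap u v q.2) ?_ ?_
    · intro q hq q' hq' heq
      rw [Finset.mem_coe, Finset.mem_filter] at hq hq'
      exact Prod.ext (hq.2.trans hq'.2.symm) (affineMap_injective u hv heq)
    · intro q hq
      rw [Finset.mem_filter] at hq
      rw [← hq.2]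
      exact (hS q hq.1).2.1)
  have h2 : (S.image Prod.fst).card ≤ (2 * D) ^ 2 := by
    refine card_le_of_prod_eq hD hn hnM _ (affineMap (-t) 1)
      (affineMap_injective _ one_ne_zero).injOn ?_
    intro x hx
    obtain ⟨q, hq, rfl⟩ := Finset.mem_image.mp hx
    rw [← (hS q hq).1]
    refine Finset.prod_congr rfl fun i _ => ?_
    simp only [affineMap]; ring
  calc S.card ≤ (2 * D) ^ 2 * (S.image Prod.fst).card := h1
    _ ≤ (2 * D) ^ 2 * (2 * D) ^ 2 := Nat.mul_le_mul_left _ h2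
    _ = _ := by ring

/-- The integer points of the cube `[1, h]³`. -/
noncomputable def cube (h : ℕ) : Finset (Fin 3 → ℤ) := Fintype.piFinset fun _ => Finset.Icc 1 (h : ℤ)

lemma mem_cube {h : ℕ} {x : Fin 3 → ℤ} : x ∈ cube h ↔ ∀ i, 1 ≤ x i ∧ x i ≤ (h : ℤ) := by
  simp [cube, Fintype.mem_piFinset]

/-- The coefficients of `∏ (x i + T) - ∏ (y i + T)` as a polynomial in `T`. -/
def diffCoeffs (q : (Fin 3 → ℤ) × (Fin 3 → ℤ)) : ℤ × ℤ × ℤ :=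
  (q.1 0 + q.1 1 + q.1 2 - (q.2 0 + q.2 1 + q.2 2),
    q.1 0 * q.1 1 + q.1 0 * q.1 2 + q.1 1 * q.1 2 -
      (q.2 0 * q.2 1 + q.2 0 * q.2 2 + q.2 1 * q.2 2),
    q.1 0 * q.1 1 * q.1 2 - q.2 0 * q.2 1 * q.2 2)

lemma diffCoeffs_eval {R : Type*} [CommRing R] (q : (Fin 3 → ℤ) × (Fin 3 → ℤ)) (u v : R) :
    v * (((diffCoeffs q).1 : R) * u ^ 2 + ((diffCoeffs q).2.1 : R) * u * v +
      ((diffCoeffs q).2.2 : R) * v ^ 2) =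
      ∏ i, (u + v * (q.1 i : R)) - ∏ i, (u + v * (q.2 i : R)) := by
  simp only [diffCoeffs, Fin.prod_univ_three]
  push_cast
  ring

lemma mul_mem_Icc {h k a b : ℤ} (ha : 1 ≤ a ∧ a ≤ h) (hb : 1 ≤ b ∧ b ≤ k) :
    1 ≤ a * b ∧ a * b ≤ h * k :=
  ⟨by nlinarith, mul_le_mul ha.2 hb.2 (by linarith) (by linarith)⟩

lemma abs_diffCoeffs_le {h : ℕ} {q : (Fin 3 → ℤ) × (Fin 3 → ℤ)} (h1 : q.1 ∈ cube h)
    (h2 : q.2 ∈ cube h) : |(diffCoeffs q).1| ≤ 3 * (h : ℤ) ∧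
      |(diffCoeffs q).2.1| ≤ 3 * (h : ℤ) ^ 2 ∧ |(diffCoeffs q).2.2| ≤ (h : ℤ) ^ 3 := by
  rw [mem_cube] at h1 h2
  have hx := fun i j => mul_mem_Icc (h1 i) (h1 j)
  have hy := fun i j => mul_mem_Icc (h2 i) (h2 j)
  have hx3 := mul_mem_Icc (hx 0 1) (h1 2)
  have hy3 := mul_mem_Icc (hy 0 1) (h2 2)
  simp only [diffCoeffs, abs_le]
  refine ⟨⟨?_, ?_⟩, ⟨?_, ?_⟩, ?_, ?_⟩
  · linarith [h1 0, h1 1, h1 2, h2 0, h2 1, h2 2]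
  · linarith [h1 0, h1 1, h1 2, h2 0, h2 1, h2 2]
  · linarith [hx 0 1, hx 0 2, hx 1 2, hy 0 1, hy 0 2, hy 1 2]
  · linarith [hx 0 1, hx 0 2, hx 1 2, hy 0 1, hy 0 2, hy 1 2]
  · linarith
  · linarith

lemma prod_sub_ne_zero {q : (Fin 3 → ℤ) × (Fin 3 → ℤ)} (hq : ∀ i, q.1 i ≠ q.2 0) :
    ∏ i, (q.1 i - q.2 0) ≠ 0 :=
  Finset.prod_ne_zero_iff.mpr fun i _ => sub_ne_zero.mpr (hq i)

lemma abs_prod_sub_le {h : ℕ} {q : (Fin 3 → ℤ) × (Fin 3 → ℤ)} (h1 : q.1 ∈ cube h)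
    (h2 : q.2 ∈ cube h) : |∏ i, (q.1 i - q.2 0)| ≤ (h : ℤ) ^ 3 := by
  rw [mem_cube] at h1 h2
  rw [Finset.abs_prod]
  calc _ ≤ ∏ _i : Fin 3, (h : ℤ) := by
        refine Finset.prod_le_prod (fun _ _ => abs_nonneg _) fun i _ => ?_
        rw [abs_le]
        constructor <;> linarith [h1 i, h2 0]
    _ = _ := by simp

/-- At most `16 h D⁴` pairs of triples have a given difference polynomial. -/
lemma card_fiber_diffCoeffs_le {D h : ℕ}
    (hD : ∀ n : ℕ, n ≠ 0 → n ≤ h ^ 3 → n.divisors.card ≤ D)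
    (S : Finset ((Fin 3 → ℤ) × (Fin 3 → ℤ))) (w : ℤ × ℤ × ℤ)
    (hS : ∀ q ∈ S, q.1 ∈ cube h ∧ q.2 ∈ cube h ∧ (∀ i, q.1 i ≠ q.2 0) ∧ diffCoeffs q = w) :
    S.card ≤ (2 * D) ^ 4 * h := by
  classical
  have h1 := Finset.card_le_mul_card_image (f := fun q : (Fin 3 → ℤ) × (Fin 3 → ℤ) => q.2 0) S
    ((2 * D) ^ 4) (fun t ht => by
    obtain ⟨q₀, hq₀, rfl⟩ := Finset.mem_image.mp ht
    obtain ⟨a1, a2, a3, a4⟩ := hS q₀ hq₀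
    refine card_pairs_le_of_prod_eq (M := h ^ 3) hD (prod_sub_ne_zero a3)
      (by exact_mod_cast abs_prod_sub_le a1 a2) (t := q₀.2 0) (u := 0) (v := 1) one_ne_zero
      (fun x => ∏ i, x i - w.2.2) _ ?_
    intro q hq
    rw [Finset.mem_filter] at hq
    obtain ⟨hq, hq0⟩ := hq
    obtain ⟨b1, b2, b3, b4⟩ := hS q hq
    have e : ∏ i, q.1 i - w.2.2 = ∏ i, q.2 i := by
      rw [← b4]
      simp only [diffCoeffs, Fin.prod_univ_three]
      ring
    refine ⟨?_, ?_, ?_, ?_⟩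
    · have r0 := diffCoeffs_eval q₀ (-q₀.2 0) 1
      have r1 := diffCoeffs_eval q (-q₀.2 0) 1
      rw [a4] at r0
      rw [b4, r0] at r1
      simp only [Fin.prod_univ_three, Int.cast_id] at r1 ⊢
      rw [show q.2 0 = q₀.2 0 from hq0] at r1
      linear_combination -r1
    · simp only [e]
      simp
    · simp only [e]
      rw [mem_cube] at b2
      exact Finset.prod_ne_zero_iff.mpr fun i _ => by linarith [b2 i]
    · simp only [e]
      rw [mem_cube] at b2
      have := mul_mem_Icc (mul_mem_Icc (b2 0) (b2 1)) (b2 2)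
      rw [Fin.prod_univ_three, abs_of_nonneg (by linarith)]
      push_cast
      linarith)
  have h2 : (S.image fun q : (Fin 3 → ℤ) × (Fin 3 → ℤ) => q.2 0) ⊆ Finset.Icc 1 (h : ℤ) := by
    intro t ht
    obtain ⟨q, hq, rfl⟩ := Finset.mem_image.mp ht
    exact Finset.mem_Icc.mpr (mem_cube.mp (hS q hq).2.1 0)
  have h3 := Finset.card_le_card h2
  rw [Int.card_Icc] at h3
  calc _ ≤ _ := h1
    _ ≤ _ := Nat.mul_le_mul_left _ (by omega)

/-- The two products of the linear form `u + v x` agree, no factor vanishes, and `q.2 0` does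
not occur among the entries of `q.1`. -/
structure IsRationalSolution (h : ℕ) (u v : ℤ) (q : (Fin 3 → ℤ) × (Fin 3 → ℤ)) : Prop where
  fst_mem : q.1 ∈ cube h
  snd_mem : q.2 ∈ cube h
  ne : ∀ i, q.1 i ≠ q.2 0
  prod_eq : ∏ i, (u + v * q.1 i) = ∏ i, (u + v * q.2 i)
  snd_ne_zero : ∀ i, u + v * q.2 i ≠ 0

lemma abs_prod_affine_le {h : ℕ} {u v : ℤ} (huv : |u| + |v| * h ≤ (h : ℤ) ^ 6)
    {x : Fin 3 → ℤ} (hx : x ∈ cube h) : |∏ i, (u + v * x i)| ≤ (h : ℤ) ^ 18 := by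
  rw [mem_cube] at hx
  rw [Finset.abs_prod]
  calc _ ≤ ∏ _i : Fin 3, (h : ℤ) ^ 6 := by
        refine Finset.prod_le_prod (fun _ _ => abs_nonneg _) fun i _ => ?_
        have h1 : |x i| ≤ h := by rw [abs_le]; constructor <;> linarith [hx i]
        calc |u + v * x i| ≤ |u| + |v * x i| := abs_add_le _ _
          _ = |u| + |v| * |x i| := by rw [abs_mul]
          _ ≤ |u| + |v| * h := by gcongr
          _ ≤ _ := huv
    _ = _ := by simp [← pow_mul]

lemma IsRationalSolution.dvd_prod_sub {h : ℕ} {u v : ℤ} (huv : IsCoprime u v)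
    {q : (Fin 3 → ℤ) × (Fin 3 → ℤ)} (hq : IsRationalSolution h u v q) :
    u + v * q.2 0 ∣ ∏ i, (q.1 i - q.2 0) := by
  have hcop : IsCoprime (u + v * q.2 0) (v ^ 3) :=
    ((IsCoprime.add_mul_left_left_iff).mpr huv).pow_right
  apply hcop.dvd_of_dvd_mul_left
  have h1 := hq.prod_eq
  simp only [Fin.prod_univ_three] at h1 ⊢
  set Y := u + v * q.2 0 with hY
  have e : ∀ i, v * (q.1 i - q.2 0) = (u + v * q.1 i) - Y := by intro i; rw [hY]; ring
  refine ⟨(u + v * q.2 1) * (u + v * q.2 2) - (u + v * q.1 0) * (u + v * q.1 1)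
    - (u + v * q.1 0) * (u + v * q.1 2) - (u + v * q.1 1) * (u + v * q.1 2)
    + Y * ((u + v * q.1 0) + (u + v * q.1 1) + (u + v * q.1 2)) - Y ^ 2, ?_⟩
  calc _ = (v * (q.1 0 - q.2 0)) * (v * (q.1 1 - q.2 0)) * (v * (q.1 2 - q.2 0)) := by ring
    _ = _ := by rw [e, e, e]; linear_combination h1

lemma card_slice_mul_abs_le {D h : ℕ}
    (hD : ∀ n : ℕ, n ≠ 0 → n ≤ h ^ 18 → n.divisors.card ≤ D) {u v : ℤ} (hcop : IsCoprime u v)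
    (hv : v ≠ 0) (huv : |u| + |v| * h ≤ (h : ℤ) ^ 6) (t : ℤ)
    (S : Finset ((Fin 3 → ℤ) × (Fin 3 → ℤ))) (hS : ∀ q ∈ S, IsRationalSolution h u v q)
    (hSt : ∀ q ∈ S, q.2 0 = t) :
    (S.card : ℤ) * |u + v * t| ≤ 2 * (h : ℤ) ^ 3 * (2 * D) ^ 4 := by
  classical
  rcases S.eq_empty_or_nonempty with rfl | ⟨q₁, hq₁⟩
  · simp; positivity
  have hY : u + v * t ≠ 0 := hSt q₁ hq₁ ▸ (hS q₁ hq₁).snd_ne_zero 0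
  set Y := u + v * t with hYdef
  have hYpos : 0 < |Y| := abs_pos.mpr hY
  have hh1 : 1 ≤ h := by
    have := mem_cube.mp (hS q₁ hq₁).fst_mem 0
    omega
  have hpow : (h : ℤ) ^ 3 ≤ (h : ℤ) ^ 18 := pow_le_pow_right₀ (by exact_mod_cast hh1) (by norm_num)
  have hfac : ∀ q ∈ S, ∃ m, ∏ i, (q.1 i - t) = Y * m := by
    intro q hq
    have := (hS q hq).dvd_prod_sub hcop
    rwa [hSt q hq] at this
  have hbound : ∀ q ∈ S, |∏ i, (q.1 i - t)| ≤ (h : ℤ) ^ 3 := by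
    intro q hq
    rw [← hSt q hq]
    exact abs_prod_sub_le (hS q hq).fst_mem (hS q hq).snd_mem
  have hne : ∀ q ∈ S, ∏ i, (q.1 i - t) ≠ 0 := by
    intro q hq
    rw [← hSt q hq]
    exact prod_sub_ne_zero (hS q hq).ne
  set f : (Fin 3 → ℤ) × (Fin 3 → ℤ) → ℤ := fun q => (∏ i, (q.1 i - t)) / Y with hf
  have hfY : ∀ q ∈ S, ∏ i, (q.1 i - t) = Y * f q := by
    intro q hq
    obtain ⟨m, hm⟩ := hfac q hq
    rw [hf]; simp only [hm]
    rw [Int.mul_ediv_cancel_left _ hY]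
  have h1 := Finset.card_le_mul_card_image (f := f) S ((2 * D) ^ 4) (fun m hm => by
    obtain ⟨q₀, hq₀, rfl⟩ := Finset.mem_image.mp hm
    refine card_pairs_le_of_prod_eq (M := h ^ 18) hD (hne q₀ hq₀)
      (by push_cast; exact (hbound q₀ hq₀).trans hpow) (t := t) (u := u) (v := v) hv
      (fun x => ∏ i, (u + v * x i)) _ ?_
    intro q hq
    rw [Finset.mem_filter] at hq
    obtain ⟨hq, hq0⟩ := hq
    have hs := hS q hq
    refine ⟨by rw [hfY q hq, hq0, ← hfY q₀ hq₀], hs.prod_eq.symm, ?_, ?_⟩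
    · simp only [hs.prod_eq]
      exact Finset.prod_ne_zero_iff.mpr fun i _ => hs.snd_ne_zero i
    · push_cast
      exact abs_prod_affine_le huv hs.fst_mem)
  set Q := (h : ℤ) ^ 3 / |Y| with hQ
  have hQ0 : 0 ≤ Q := Int.ediv_nonneg (by positivity) hYpos.le
  have h2 : S.image f ⊆ (Finset.Icc (-Q) Q).erase 0 := by
    intro m hm
    obtain ⟨q, hq, rfl⟩ := Finset.mem_image.mp hm
    rw [Finset.mem_erase, Finset.mem_Icc, ← abs_le]
    constructor
    · intro h0
      have := hfY q hq
      rw [h0, mul_zero] at this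
      exact hne q hq this
    · rw [hQ, Int.le_ediv_iff_mul_le hYpos, ← abs_mul, mul_comm, ← hfY q hq]
      exact hbound q hq
  have h3 := Finset.card_le_card h2
  rw [Finset.card_erase_of_mem (Finset.mem_Icc.mpr ⟨by linarith, hQ0⟩), Int.card_Icc] at h3
  have h4 : ((S.image f).card : ℤ) ≤ 2 * Q := by omega
  have h5 : Q * |Y| ≤ (h : ℤ) ^ 3 := Int.ediv_mul_le _ hYpos.ne'
  have h6 : (S.card : ℤ) ≤ (2 * D) ^ 4 * (S.image f).card := by exact_mod_cast h1
  calc (S.card : ℤ) * |Y| ≤ ((2 * D) ^ 4 * (S.image f).card) * |Y| := by gcongr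
    _ ≤ ((2 * D) ^ 4 * (2 * Q)) * |Y| := by gcongr
    _ = 2 * (2 * D) ^ 4 * (Q * |Y|) := by ring
    _ ≤ 2 * (2 * D) ^ 4 * (h : ℤ) ^ 3 := by gcongr
    _ = _ := by ring

lemma card_slice_le {D h : ℕ}
    (hD : ∀ n : ℕ, n ≠ 0 → n ≤ h ^ 18 → n.divisors.card ≤ D) {u v : ℤ}
    (hv : v ≠ 0) (huv : |u| + |v| * h ≤ (h : ℤ) ^ 6) (t : ℤ)
    (S : Finset ((Fin 3 → ℤ) × (Fin 3 → ℤ))) (hS : ∀ q ∈ S, IsRationalSolution h u v q)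
    (hSt : ∀ q ∈ S, q.2 0 = t) : S.card ≤ (2 * D) ^ 2 * h ^ 2 := by
  classical
  have h1 := Finset.card_le_mul_card_image (f := Prod.snd) S ((2 * D) ^ 2) (fun y hy => by
    obtain ⟨q₀, hq₀, rfl⟩ := Finset.mem_image.mp hy
    have hs := hS q₀ hq₀
    refine card_le_of_prod_eq (M := h ^ 18) hD (n := ∏ i, (u + v * q₀.2 i))
      (Finset.prod_ne_zero_iff.mpr fun i _ => hs.snd_ne_zero i)
      (by push_cast; exact abs_prod_affine_le huv hs.snd_mem) _
      (fun q => affineMap u v q.1) ?_ ?_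
    · intro q hq q' hq' heq
      rw [Finset.mem_coe, Finset.mem_filter] at hq hq'
      exact Prod.ext (affineMap_injective u hv heq) (hq.2.trans hq'.2.symm)
    · intro q hq
      rw [Finset.mem_filter] at hq
      rw [← hq.2]
      exact (hS q hq.1).prod_eq)
  have h2 : (S.image Prod.snd).card ≤ (Finset.Icc 1 (h : ℤ) ×ˢ Finset.Icc 1 (h : ℤ)).card := by
    refine Finset.card_le_card_of_injOn (fun y : Fin 3 → ℤ => (y 1, y 2)) ?_ ?_
    · intro y hy
      obtain ⟨q, hq, rfl⟩ := Finset.mem_image.mp hy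
      have := mem_cube.mp (hS q hq).snd_mem
      exact Finset.mem_coe.mpr (Finset.mem_product.mpr
        ⟨Finset.mem_Icc.mpr (this 1), Finset.mem_Icc.mpr (this 2)⟩)
    · intro y hy y' hy' heq
      obtain ⟨q, hq, rfl⟩ := Finset.mem_image.mp (Finset.mem_coe.mp hy)
      obtain ⟨q', hq', rfl⟩ := Finset.mem_image.mp (Finset.mem_coe.mp hy')
      simp only [Prod.mk.injEq] at heq
      funext i
      fin_cases i
      · exact (hSt q hq).trans (hSt q' hq').symm
      · exact heq.1
      · exact heq.2
  rw [Finset.card_product, Int.card_Icc] at h2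
  calc S.card ≤ _ := h1
    _ ≤ (2 * D) ^ 2 * (h * h) := Nat.mul_le_mul_left _ (by simpa using h2)
    _ = _ := by ring

lemma card_eq_sum_slices {h : ℕ} (S : Finset ((Fin 3 → ℤ) × (Fin 3 → ℤ)))
    (hS : ∀ q ∈ S, q.2 ∈ cube h) :
    (S.card : ℝ) = ∑ t ∈ Finset.Icc 1 (h : ℤ), ((S.filter fun q => q.2 0 = t).card : ℝ) := by
  have := Finset.card_eq_sum_card_fiberwise (s := S) (t := Finset.Icc 1 (h : ℤ))
    (f := fun q : (Fin 3 → ℤ) × (Fin 3 → ℤ) => q.2 0)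
    (fun q hq => Finset.mem_coe.mpr (Finset.mem_Icc.mpr (mem_cube.mp (hS q hq) 0)))
  exact_mod_cast this

lemma card_slice_le_div {D h : ℕ}
    (hD : ∀ n : ℕ, n ≠ 0 → n ≤ h ^ 18 → n.divisors.card ≤ D) {u v : ℤ} (hcop : IsCoprime u v)
    (hv : v ≠ 0) (huv : |u| + |v| * h ≤ (h : ℤ) ^ 6) (t : ℤ)
    (S : Finset ((Fin 3 → ℤ) × (Fin 3 → ℤ))) (hS : ∀ q ∈ S, IsRationalSolution h u v q)
    {R : ℝ} (hR : 0 < R) (hRt : R ≤ |(u : ℝ) + v * t|) :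
    ((S.filter fun q => q.2 0 = t).card : ℝ) ≤ 2 * (h : ℝ) ^ 3 * (2 * D) ^ 4 / R := by
  have h1 := card_slice_mul_abs_le hD hcop hv huv t (S.filter fun q => q.2 0 = t)
    (fun q hq => hS q (Finset.mem_filter.mp hq).1) (fun q hq => (Finset.mem_filter.mp hq).2)
  have h2 : ((S.filter fun q => q.2 0 = t).card : ℝ) * |(u : ℝ) + v * t| ≤
      2 * (h : ℝ) ^ 3 * (2 * D) ^ 4 := by exact_mod_cast h1
  rw [le_div_iff₀ hR]
  exact (mul_le_mul_of_nonneg_left hRt (by positivity)).trans h2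

lemma card_le_of_forall_large {D h : ℕ}
    (hD : ∀ n : ℕ, n ≠ 0 → n ≤ h ^ 18 → n.divisors.card ≤ D) {u v : ℤ} (hcop : IsCoprime u v)
    (hv : v ≠ 0) (huv : |u| + |v| * h ≤ (h : ℤ) ^ 6)
    (S : Finset ((Fin 3 → ℤ) × (Fin 3 → ℤ))) (hS : ∀ q ∈ S, IsRationalSolution h u v q)
    {R : ℝ} (hR : 0 < R) (hRt : ∀ t ∈ Finset.Icc 1 (h : ℤ), R ≤ |(u : ℝ) + v * t|) :
    (S.card : ℝ) ≤ 2 * (h : ℝ) ^ 4 * (2 * D) ^ 4 / R := by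
  rw [card_eq_sum_slices S fun q hq => (hS q hq).snd_mem]
  calc _ ≤ ∑ _t ∈ Finset.Icc 1 (h : ℤ), 2 * (h : ℝ) ^ 3 * (2 * D) ^ 4 / R :=
        Finset.sum_le_sum fun t ht => card_slice_le_div hD hcop hv huv t S hS hR (hRt t ht)
    _ = _ := by
      rw [Finset.sum_const, Int.card_Icc, nsmul_eq_mul, add_sub_cancel_right, Int.toNat_natCast]
      ring

lemma sum_inv_abs_sub_le {h : ℕ} {t₀ : ℤ} (ht₀ : t₀ ∈ Finset.Icc 1 (h : ℤ)) :
    ∑ t ∈ (Finset.Icc 1 (h : ℤ)).erase t₀, (|(t : ℝ) - t₀|)⁻¹ ≤ 2 * (1 + Real.log h) := by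
  have hmaps : ∀ t ∈ (Finset.Icc 1 (h : ℤ)).erase t₀, (t - t₀).natAbs ∈ Finset.Icc 1 h := by
    intro t ht
    rw [Finset.mem_erase, Finset.mem_Icc] at ht
    rw [Finset.mem_Icc] at ht₀ ⊢
    omega
  have hval : ∀ t : ℤ, |(t : ℝ) - t₀| = ((t - t₀).natAbs : ℝ) := by
    intro t
    rw [Nat.cast_natAbs]
    push_cast
    rfl
  rw [← Finset.sum_fiberwise_of_maps_to hmaps]
  calc _ ≤ ∑ k ∈ Finset.Icc 1 h, 2 * (k : ℝ)⁻¹ := by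
        refine Finset.sum_le_sum fun k _ => ?_
        rw [Finset.sum_congr rfl (g := fun _ => (k : ℝ)⁻¹) fun t ht => by
          rw [hval, (Finset.mem_filter.mp ht).2], Finset.sum_const, nsmul_eq_mul]
        gcongr
        have : ((Finset.Icc 1 (h : ℤ)).erase t₀).filter (fun t => (t - t₀).natAbs = k) ⊆
            {t₀ + k, t₀ - k} := by
          intro t ht
          have := (Finset.mem_filter.mp ht).2
          rw [Finset.mem_insert, Finset.mem_singleton]
          omega
        exact_mod_cast (Finset.card_le_card this).trans Finset.card_le_two
    _ = 2 * ((harmonic h : ℚ) : ℝ) := by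
        rw [harmonic_eq_sum_Icc, ← Finset.mul_sum]
        push_cast
        rfl
    _ ≤ _ := by
        gcongr
        exact harmonic_le_one_add_log h

lemma card_le_of_large_denominator {D h : ℕ} (hh : 1 ≤ h)
    (hD : ∀ n : ℕ, n ≠ 0 → n ≤ h ^ 18 → n.divisors.card ≤ D) {u v : ℤ} (hcop : IsCoprime u v)
    (hv : v ≠ 0) (huv : |u| + |v| * h ≤ (h : ℤ) ^ 6)
    (S : Finset ((Fin 3 → ℤ) × (Fin 3 → ℤ))) (hS : ∀ q ∈ S, IsRationalSolution h u v q) :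
    (S.card : ℝ) ≤ (2 * D) ^ 2 * (h : ℝ) ^ 2 +
      8 * (h : ℝ) ^ 3 * (2 * D) ^ 4 * (1 + Real.log h) / |(v : ℝ)| := by
  obtain ⟨t₀, ht₀, hmin⟩ := Finset.exists_min_image (Finset.Icc 1 (h : ℤ))
    (fun t : ℤ => |(u : ℝ) + v * t|) ⟨1, Finset.mem_Icc.mpr ⟨le_rfl, by exact_mod_cast hh⟩⟩
  have hv0 : 0 < |(v : ℝ)| := abs_pos.mpr (by exact_mod_cast hv)
  rw [card_eq_sum_slices S fun q hq => (hS q hq).snd_mem, ← Finset.add_sum_erase _ _ ht₀]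
  gcongr
  · have := card_slice_le hD hv huv t₀ (S.filter fun q => q.2 0 = t₀)
      (fun q hq => hS q (Finset.mem_filter.mp hq).1) (fun q hq => (Finset.mem_filter.mp hq).2)
    exact_mod_cast this
  · calc _ ≤ ∑ t ∈ (Finset.Icc 1 (h : ℤ)).erase t₀,
          4 * (h : ℝ) ^ 3 * (2 * D) ^ 4 / |(v : ℝ)| * (|(t : ℝ) - t₀|)⁻¹ := by
          refine Finset.sum_le_sum fun t ht => ?_
          rw [Finset.mem_erase] at ht
          have hne : 0 < |(t : ℝ) - t₀| :=
            abs_pos.mpr (sub_ne_zero.mpr (by exact_mod_cast ht.1))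
          have hge : |(v : ℝ)| * |(t : ℝ) - t₀| / 2 ≤ |(u : ℝ) + v * t| := by
            have h1 := hmin t ht.2
            have h2 : |(v : ℝ)| * |(t : ℝ) - t₀| ≤ |(u : ℝ) + v * t| + |(u : ℝ) + v * t₀| := by
              rw [← abs_mul]
              refine le_trans (le_of_eq ?_) (abs_sub _ _)
              congr 1; ring
            linarith
          refine (card_slice_le_div hD hcop hv huv t S hS (by positivity) hge).trans_eq ?_
          field_simp
          ring
      _ ≤ 4 * (h : ℝ) ^ 3 * (2 * D) ^ 4 / |(v : ℝ)| * (2 * (1 + Real.log h)) := by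
          rw [← Finset.mul_sum]
          gcongr
          exact sum_inv_abs_sub_le ht₀
      _ = _ := by ring

lemma perm_of_prod_eq_of_range_eq {K : Type*} [Field K] {a b c x y z : K} (ha : a ≠ 0)
    (hb : b ≠ 0) (hc : c ≠ 0) (h : a * b * c = x * y * z)
    (hx : x = a ∨ x = b ∨ x = c) (hy : y = a ∨ y = b ∨ y = c) (hz : z = a ∨ z = b ∨ z = c)
    (ha' : x = a ∨ y = a ∨ z = a) (hb' : x = b ∨ y = b ∨ z = b) (hc' : x = c ∨ y = c ∨ z = c) :
    (x = a ∧ y = b ∧ z = c) ∨ (x = a ∧ y = c ∧ z = b) ∨ (x = b ∧ y = a ∧ z = c) ∨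
    (x = b ∧ y = c ∧ z = a) ∨ (x = c ∧ y = a ∧ z = b) ∨ (x = c ∧ y = b ∧ z = a) := by
  have key : ∀ {s t : K}, s ≠ 0 → t ≠ 0 → s * s * t = s * t * t → s = t := by
    intro s t hs ht h
    have : (s * t) * s = (s * t) * t := by linear_combination h
    exact mul_left_cancel₀ (mul_ne_zero hs ht) this
  have k1 := key ha hb
  have k2 := key ha hc
  have k3 := key hb hc
  have k4 := key hb ha
  have k5 := key hc ha
  have k6 := key hc hb
  rcases hx with rfl | rfl | rfl <;> rcases hy with rfl | rfl | rfl <;>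
    rcases hz with rfl | rfl | rfl <;> grind

section Solutions

variable {p : ℕ} [Fact p.Prime]

open Classical in
/-- The pairs of triples counted by `K₃(p, h, s)`. -/
noncomputable def solutions (h : ℕ) (s : ZMod p) : Finset ((Fin 3 → ℤ) × (Fin 3 → ℤ)) :=
  (cube h ×ˢ cube h).filter fun q =>
    (∏ i, ((q.1 i : ZMod p) + s)) = (∏ i, ((q.2 i : ZMod p) + s)) ∧
      (∏ i, ((q.1 i : ZMod p) + s)) ≠ 0

open Classical in
/-- The solutions in which `q.2 0` does not occur among the entries of `q.1`. -/
noncomputable def properSolutions (h : ℕ) (s : ZMod p) :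
    Finset ((Fin 3 → ℤ) × (Fin 3 → ℤ)) :=
  (solutions h s).filter fun q => ∀ i, q.1 i ≠ q.2 0

lemma mem_solutions {h : ℕ} {s : ZMod p} {q : (Fin 3 → ℤ) × (Fin 3 → ℤ)} :
    q ∈ solutions h s ↔ q.1 ∈ cube h ∧ q.2 ∈ cube h ∧
      (∏ i, ((q.1 i : ZMod p) + s)) = (∏ i, ((q.2 i : ZMod p) + s)) ∧
      (∏ i, ((q.1 i : ZMod p) + s)) ≠ 0 := by
  simp only [solutions, Finset.mem_filter, Finset.mem_product, and_assoc]

lemma mem_properSolutions {h : ℕ} {s : ZMod p} {q : (Fin 3 → ℤ) × (Fin 3 → ℤ)} :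
    q ∈ properSolutions h s ↔ q ∈ solutions h s ∧ ∀ i, q.1 i ≠ q.2 0 := by
  simp only [properSolutions, Finset.mem_filter]

lemma eq_of_mem_Icc_of_cast_eq {h : ℕ} (hp : h < p) {a b : ℤ} (ha : 1 ≤ a ∧ a ≤ h)
    (hb : 1 ≤ b ∧ b ≤ h) (hab : (a : ZMod p) = b) : a = b := by
  have h1 : (p : ℤ) ∣ a - b := by
    rw [← ZMod.intCast_zmod_eq_zero_iff_dvd]
    push_cast
    rw [hab, sub_self]
  have h2 : |a - b| < p := by
    rw [abs_lt]
    constructor <;> omega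
  linarith [Int.eq_zero_of_abs_lt_dvd h1 h2]

lemma exists_perm_of_mem_solutions {h : ℕ} (hp : h < p) {s : ZMod p}
    {q : (Fin 3 → ℤ) × (Fin 3 → ℤ)} (hq : q ∈ solutions h s)
    (h1 : ∀ j, ∃ i, q.1 i = q.2 j) (h2 : ∀ j, ∃ i, q.2 i = q.1 j) :
    ∃ σ : Equiv.Perm (Fin 3), q.2 = q.1 ∘ σ := by
  obtain ⟨hx, hy, heq, hne⟩ := mem_solutions.mp hq
  rw [mem_cube] at hx hy
  have hne' := fun i => Finset.prod_ne_zero_iff.mp hne i (Finset.mem_univ _)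
  rw [Fin.prod_univ_three, Fin.prod_univ_three] at heq
  have hc1 : ∀ j, ((q.2 j : ZMod p) + s = q.1 0 + s) ∨ ((q.2 j : ZMod p) + s = q.1 1 + s) ∨
      ((q.2 j : ZMod p) + s = q.1 2 + s) := by
    intro j
    obtain ⟨i, hi⟩ := h1 j
    rw [← hi]
    fin_cases i <;> simp
  have hc2 : ∀ j, ((q.2 0 : ZMod p) + s = q.1 j + s) ∨ ((q.2 1 : ZMod p) + s = q.1 j + s) ∨
      ((q.2 2 : ZMod p) + s = q.1 j + s) := by
    intro j
    obtain ⟨i, hi⟩ := h2 j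
    rw [← hi]
    fin_cases i <;> simp
  have hinj : ∀ i j, (q.2 i : ZMod p) + s = q.1 j + s → q.2 i = q.1 j := fun i j hij =>
    eq_of_mem_Icc_of_cast_eq hp (hy i) (hx j) (add_right_cancel hij)
  have hmk : ∀ σ : Equiv.Perm (Fin 3), (q.2 0 : ZMod p) + s = q.1 (σ 0) + s →
      (q.2 1 : ZMod p) + s = q.1 (σ 1) + s → (q.2 2 : ZMod p) + s = q.1 (σ 2) + s →
      ∃ σ : Equiv.Perm (Fin 3), q.2 = q.1 ∘ σ := by
    intro σ e0 e1 e2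
    refine ⟨σ, funext fun i => ?_⟩
    fin_cases i
    · exact hinj _ _ e0
    · exact hinj _ _ e1
    · exact hinj _ _ e2
  rcases perm_of_prod_eq_of_range_eq (hne' 0) (hne' 1) (hne' 2) heq (hc1 0) (hc1 1) (hc1 2)
    (hc2 0) (hc2 1) (hc2 2) with h | h | h | h | h | h
  · exact hmk 1 h.1 h.2.1 h.2.2
  · exact hmk (Equiv.swap 1 2) h.1 h.2.1 h.2.2
  · exact hmk (Equiv.swap 0 1) h.1 h.2.1 h.2.2
  · exact hmk (Equiv.swap 0 1 * Equiv.swap 1 2) h.1 h.2.1 h.2.2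
  · exact hmk (Equiv.swap 1 2 * Equiv.swap 0 1) h.1 h.2.1 h.2.2
  · exact hmk (Equiv.swap 0 2) h.1 h.2.1 h.2.2

lemma comp_perm_mem_cube {h : ℕ} {x : Fin 3 → ℤ} (hx : x ∈ cube h) (σ : Equiv.Perm (Fin 3)) :
    x ∘ σ ∈ cube h := by
  rw [mem_cube] at hx ⊢
  exact fun i => hx (σ i)

lemma prod_comp_perm_add (s : ZMod p) (x : Fin 3 → ℤ) (σ : Equiv.Perm (Fin 3)) :
    ∏ i, (((x ∘ σ) i : ZMod p) + s) = ∏ i, ((x i : ZMod p) + s) :=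
  Equiv.prod_comp σ fun i => ((x i : ZMod p) + s)

open Classical in
lemma card_nonperm_solutions_le {h : ℕ} (hp : h < p) (s : ZMod p) :
    ((solutions h s).filter fun q => ¬ ∃ σ : Equiv.Perm (Fin 3), q.2 = q.1 ∘ σ).card ≤
      6 * (properSolutions h s).card := by
  set N₁ : Fin 3 → Finset ((Fin 3 → ℤ) × (Fin 3 → ℤ)) := fun j =>
    (solutions h s).filter fun q => ∀ i, q.1 i ≠ q.2 j with hN₁
  set N₂ : Fin 3 → Finset ((Fin 3 → ℤ) × (Fin 3 → ℤ)) := fun j =>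
    (solutions h s).filter fun q => ∀ i, q.2 i ≠ q.1 j with hN₂
  have hcomp : ∀ τ : Equiv.Perm (Fin 3), Function.Injective fun x : Fin 3 → ℤ => x ∘ τ :=
    fun τ => τ.surjective.injective_comp_right
  have c₁ : ∀ j, (N₁ j).card ≤ (properSolutions h s).card := by
    intro j
    refine Finset.card_le_card_of_injOn (fun q => (q.1, q.2 ∘ Equiv.swap 0 j)) ?_ ?_
    · intro q hq
      obtain ⟨hq, hne⟩ := Finset.mem_filter.mp hq
      obtain ⟨b1, b2, b3, b4⟩ := mem_solutions.mp hq
      refine Finset.mem_coe.mpr (mem_properSolutions.mpr ⟨mem_solutions.mpr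
        ⟨b1, comp_perm_mem_cube b2 _, ?_, b4⟩, fun i => ?_⟩)
      · rw [prod_comp_perm_add]; exact b3
      · simpa using hne i
    · intro q _ q' _ heq
      exact Prod.ext (Prod.ext_iff.mp heq).1 (hcomp _ (Prod.ext_iff.mp heq).2)
  have c₂ : ∀ j, (N₂ j).card ≤ (properSolutions h s).card := by
    intro j
    refine Finset.card_le_card_of_injOn (fun q => (q.2, q.1 ∘ Equiv.swap 0 j)) ?_ ?_
    · intro q hq
      obtain ⟨hq, hne⟩ := Finset.mem_filter.mp hq
      obtain ⟨b1, b2, b3, b4⟩ := mem_solutions.mp hq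
      refine Finset.mem_coe.mpr (mem_properSolutions.mpr ⟨mem_solutions.mpr
        ⟨b2, comp_perm_mem_cube b1 _, ?_, b3 ▸ b4⟩, fun i => ?_⟩)
      · rw [prod_comp_perm_add]; exact b3.symm
      · simpa using hne i
    · intro q _ q' _ heq
      exact Prod.ext (hcomp _ (Prod.ext_iff.mp heq).2) (Prod.ext_iff.mp heq).1
  have hsub : ((solutions h s).filter fun q => ¬ ∃ σ : Equiv.Perm (Fin 3), q.2 = q.1 ∘ σ) ⊆
      Finset.univ.biUnion N₁ ∪ Finset.univ.biUnion N₂ := by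
    intro q hq
    obtain ⟨hq, hσ⟩ := Finset.mem_filter.mp hq
    simp only [hN₁, hN₂, Finset.mem_union, Finset.mem_biUnion, Finset.mem_univ, true_and,
      Finset.mem_filter]
    by_contra hcon
    push Not at hcon
    exact hσ (exists_perm_of_mem_solutions hp hq (fun j => hcon.1 j hq) fun j => hcon.2 j hq)
  have d₁ : (Finset.univ.biUnion N₁).card ≤ 3 * (properSolutions h s).card :=
    Finset.card_biUnion_le_card_mul _ _ _ fun j _ => c₁ j
  have d₂ : (Finset.univ.biUnion N₂).card ≤ 3 * (properSolutions h s).card :=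
    Finset.card_biUnion_le_card_mul _ _ _ fun j _ => c₂ j
  have := (Finset.card_le_card hsub).trans (Finset.card_union_le _ _)
  omega

lemma card_cube (h : ℕ) : (cube h).card = h ^ 3 := by
  simp [cube, Fintype.card_piFinset]

lemma card_le_sq_of_injOn {h : ℕ} {S : Finset (Fin 3 → ℤ)} (hS : S ⊆ cube h) (i j : Fin 3)
    (hinj : Set.InjOn (fun x : Fin 3 → ℤ => (x i, x j)) S) : S.card ≤ h ^ 2 := by
  have := Finset.card_le_card_of_injOn (s := S) (t := Finset.Icc 1 (h : ℤ) ×ˢ Finset.Icc 1 (h : ℤ))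
    (fun x : Fin 3 → ℤ => (x i, x j)) (fun x hx => by
      have := mem_cube.mp (hS hx)
      exact Finset.mem_coe.mpr (Finset.mem_product.mpr
        ⟨Finset.mem_Icc.mpr (this i), Finset.mem_Icc.mpr (this j)⟩)) hinj
  rw [Finset.card_product, Int.card_Icc] at this
  simpa [sq] using this

open Classical in
lemma card_perm_solutions_le (h : ℕ) (s : ZMod p) :
    ((solutions h s).filter fun q => ∃ σ : Equiv.Perm (Fin 3), q.2 = q.1 ∘ σ).card ≤
      6 * h ^ 3 := by
  have hsub : ((solutions h s).filter fun q => ∃ σ : Equiv.Perm (Fin 3), q.2 = q.1 ∘ σ) ⊆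
      (cube h ×ˢ (Finset.univ : Finset (Equiv.Perm (Fin 3)))).image
        fun r => (r.1, r.1 ∘ r.2) := by
    intro q hq
    obtain ⟨hq, σ, hσ⟩ := Finset.mem_filter.mp hq
    exact Finset.mem_image.mpr ⟨(q.1, σ), Finset.mem_product.mpr
      ⟨(mem_solutions.mp hq).1, Finset.mem_univ _⟩, Prod.ext rfl hσ.symm⟩
  refine ((Finset.card_le_card hsub).trans Finset.card_image_le).trans ?_
  rw [Finset.card_product, card_cube, Finset.card_univ, Fintype.card_perm, Fintype.card_fin]
  simp [Nat.factorial, mul_comm]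

open Classical in
lemma le_card_perm_solutions {h : ℕ} (hp : h < p) (s : ZMod p) :
    6 * h ^ 3 ≤ ((solutions h s).filter fun q => ∃ σ : Equiv.Perm (Fin 3), q.2 = q.1 ∘ σ).card
      + 36 * h ^ 2 := by
  set G := (cube h).filter fun x : Fin 3 → ℤ => 
    Function.Injective x ∧ ∀ i, (x i : ZMod p) + s ≠ 0 with hG
  set E : Fin 3 → Fin 3 → Finset (Fin 3 → ℤ) := fun i j =>
    (cube h).filter fun x : Fin 3 → ℤ => x i = x j with hE
  set Z : Fin 3 → Finset (Fin 3 → ℤ) := fun i =>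
    (cube h).filter fun x : Fin 3 → ℤ => (x i : ZMod p) + s = 0 with hZ
  have hZeq : ∀ i, ∀ x ∈ Z i, ∀ y ∈ Z i, x i = y i := by
    intro i x hx y hy
    obtain ⟨hx1, hx2⟩ := Finset.mem_filter.mp hx
    obtain ⟨hy1, hy2⟩ := Finset.mem_filter.mp hy
    exact eq_of_mem_Icc_of_cast_eq hp (mem_cube.mp hx1 i) (mem_cube.mp hy1 i)
      (add_right_cancel (hx2.trans hy2.symm))
  have hcE : ∀ i j k : Fin 3, (∀ l, l = i ∨ l = j ∨ l = k) → (E i j).card ≤ h ^ 2 := by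
    intro i j k hijk
    refine card_le_sq_of_injOn (Finset.filter_subset _ _) i k fun x hx y hy hxy => ?_
    have hx := (Finset.mem_filter.mp hx).2
    have hy := (Finset.mem_filter.mp hy).2
    simp only [Prod.mk.injEq] at hxy
    funext l
    rcases hijk l with rfl | rfl | rfl
    · exact hxy.1
    · rw [← hx, ← hy, hxy.1]
    · exact hxy.2
  have hcZ : ∀ i j k : Fin 3, (∀ l, l = i ∨ l = j ∨ l = k) → (Z i).card ≤ h ^ 2 := by
    intro i j k hijk
    refine card_le_sq_of_injOn (Finset.filter_subset _ _) j k fun x hx y hy hxy => ?_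
    simp only [Prod.mk.injEq] at hxy
    funext l
    rcases hijk l with rfl | rfl | rfl
    · exact hZeq _ x hx y hy
    · exact hxy.1
    · exact hxy.2
  have hcover : cube h ⊆ G ∪ ((E 0 1 ∪ E 0 2 ∪ E 1 2) ∪ (Z 0 ∪ Z 1 ∪ Z 2)) := by
    intro x hx
    simp only [hG, hE, hZ, Finset.mem_union, Finset.mem_filter, hx, true_and]
    by_contra hcon
    push Not at hcon
    obtain ⟨h1, ⟨⟨e1, e2⟩, e3⟩, ⟨z1, z2⟩, z3⟩ := hcon
    obtain ⟨i, hi⟩ := h1 (by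
      intro i j hij
      fin_cases i <;> fin_cases j <;> first | rfl | exact absurd hij ‹_› | exact absurd hij.symm ‹_›)
    fin_cases i
    · exact z1 hi
    · exact z2 hi
    · exact z3 hi
  have hGcard : h ^ 3 ≤ G.card + 6 * h ^ 2 := by
    have h0 := Finset.card_le_card hcover
    rw [card_cube] at h0
    have h1 := Finset.card_union_le G ((E 0 1 ∪ E 0 2 ∪ E 1 2) ∪ (Z 0 ∪ Z 1 ∪ Z 2))
    have h2 := Finset.card_union_le (E 0 1 ∪ E 0 2 ∪ E 1 2) (Z 0 ∪ Z 1 ∪ Z 2)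
    have h3 := Finset.card_union_le (E 0 1 ∪ E 0 2) (E 1 2)
    have h4 := Finset.card_union_le (E 0 1) (E 0 2)
    have h5 := Finset.card_union_le (Z 0 ∪ Z 1) (Z 2)
    have h6 := Finset.card_union_le (Z 0) (Z 1)
    have := hcE 0 1 2 (by decide)
    have := hcE 0 2 1 (by decide)
    have := hcE 1 2 0 (by decide)
    have := hcZ 0 1 2 (by decide)
    have := hcZ 1 2 0 (by decide)
    have := hcZ 2 0 1 (by decide)
    omega
  have hinj := Finset.card_le_card_of_injOn
    (s := G ×ˢ (Finset.univ : Finset (Equiv.Perm (Fin 3))))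
    (t := (solutions h s).filter fun q => ∃ σ : Equiv.Perm (Fin 3), q.2 = q.1 ∘ σ)
    (fun r => (r.1, r.1 ∘ r.2)) (fun r hr => by
      have hr := (Finset.mem_product.mp (Finset.mem_coe.mp hr)).1
      obtain ⟨hr1, hr2, hr3⟩ := Finset.mem_filter.mp hr
      refine Finset.mem_coe.mpr (Finset.mem_filter.mpr ⟨mem_solutions.mpr
        ⟨hr1, comp_perm_mem_cube hr1 _, (prod_comp_perm_add s _ _).symm, ?_⟩, r.2, rfl⟩)
      exact Finset.prod_ne_zero_iff.mpr fun i _ => hr3 i) (by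
      rintro ⟨x, σ⟩ hr ⟨x', σ'⟩ hr' heq
      have hr := (Finset.mem_product.mp (Finset.mem_coe.mp hr)).1
      obtain ⟨-, hx, -⟩ := Finset.mem_filter.mp hr
      simp only [Prod.mk.injEq] at heq
      obtain ⟨rfl, h2⟩ := heq
      have : σ = σ' := Equiv.ext fun i => hx (congrFun h2 i)
      rw [this])
  rw [Finset.card_product, Finset.card_univ, Fintype.card_perm, Fintype.card_fin] at hinj
  have h6 : Nat.factorial 3 = 6 := rfl
  rw [h6] at hinj
  omega

lemma abs_card_solutions_sub_le {h : ℕ} (hp : h < p) (s : ZMod p) :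
    |((solutions h s).card : ℝ) - 6 * (h : ℝ) ^ 3| ≤
      36 * (h : ℝ) ^ 2 + 6 * (properSolutions h s).card := by
  classical
  have h1 := Finset.card_filter_add_card_filter_not (s := solutions h s)
    (fun q => ∃ σ : Equiv.Perm (Fin 3), q.2 = q.1 ∘ σ)
  have h2 := card_nonperm_solutions_le hp s
  have h3 := card_perm_solutions_le h s
  have h4 := le_card_perm_solutions hp s
  have h5 : 6 * h ^ 3 ≤ (solutions h s).card + 36 * h ^ 2 := by omega
  have h6 : (solutions h s).card ≤ 6 * h ^ 3 + 6 * (properSolutions h s).card := by omega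
  have h5' : 6 * (h : ℝ) ^ 3 ≤ (solutions h s).card + 36 * (h : ℝ) ^ 2 := by exact_mod_cast h5
  have h6' : ((solutions h s).card : ℝ) ≤ 6 * (h : ℝ) ^ 3 + 6 * (properSolutions h s).card := by
    exact_mod_cast h6
  have h7 : (0 : ℝ) ≤ (properSolutions h s).card := by positivity
  have h8 : (0 : ℝ) ≤ (h : ℝ) ^ 2 := by positivity
  rw [abs_le]
  constructor <;> linarith

end Solutions

lemma card_le_of_few_polynomials {ε : ℝ} (hε : 0 < ε) (hε2 : ε < 2) {p h N : ℕ} (hh : 5 ≤ h)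
    (hp : (h : ℝ) ^ (4 + ε) ≤ p)
    (hN : ¬ (7 * (h : ℤ) < N ∧ 5292 * (h : ℤ) ^ 6 < p * N ∧
      15876 * (h : ℤ) ^ 8 < p * (N : ℤ) ^ 2)) :
    (N : ℝ) ≤ 5292 * (h : ℝ) ^ (2 - ε / 2) := by
  have hh1 : (1 : ℝ) ≤ h := by exact_mod_cast (by omega : 1 ≤ h)
  have hh0 : (0 : ℝ) < h := by linarith
  have hpos : 0 < (h : ℝ) ^ (4 + ε) := by positivity
  rw [not_and_or, not_and_or, not_lt, not_lt, not_lt] at hN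
  rcases hN with hN | hN | hN
  · have hN' : (N : ℝ) ≤ 7 * h := by exact_mod_cast hN
    have : (h : ℝ) ≤ (h : ℝ) ^ (2 - ε / 2) := by
      conv_lhs => rw [← Real.rpow_one (h : ℝ)]
      exact Real.rpow_le_rpow_of_exponent_le hh1 (by linarith)
    linarith
  · have hN' : (p : ℝ) * N ≤ 5292 * (h : ℝ) ^ 6 := by exact_mod_cast hN
    have e : (h : ℝ) ^ 6 = (h : ℝ) ^ (4 + ε) * (h : ℝ) ^ (2 - ε) := by
      rw [← Real.rpow_add hh0, ← Real.rpow_natCast]; norm_num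
    have h1 : (h : ℝ) ^ (4 + ε) * N ≤ (h : ℝ) ^ (4 + ε) * (5292 * (h : ℝ) ^ (2 - ε)) := by
      calc _ ≤ (p : ℝ) * N := by gcongr
        _ ≤ _ := hN'
        _ = _ := by rw [e]; ring
    have h2 := le_of_mul_le_mul_left h1 hpos
    have h3 : (h : ℝ) ^ (2 - ε) ≤ (h : ℝ) ^ (2 - ε / 2) :=
      Real.rpow_le_rpow_of_exponent_le hh1 (by linarith)
    linarith
  · have hN' : (p : ℝ) * (N : ℝ) ^ 2 ≤ 15876 * (h : ℝ) ^ 8 := by exact_mod_cast hN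
    have e : (h : ℝ) ^ 8 = (h : ℝ) ^ (4 + ε) * ((h : ℝ) ^ (2 - ε / 2)) ^ 2 := by
      rw [sq, ← Real.rpow_add hh0, ← Real.rpow_add hh0, ← Real.rpow_natCast]
      congr 1
      push_cast
      ring
    have h1 : (h : ℝ) ^ (4 + ε) * (N : ℝ) ^ 2 ≤
        (h : ℝ) ^ (4 + ε) * (126 * (h : ℝ) ^ (2 - ε / 2)) ^ 2 := by
      calc _ ≤ (p : ℝ) * (N : ℝ) ^ 2 := by gcongr
        _ ≤ _ := hN'
        _ = _ := by rw [e]; ring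
    have h2 := le_of_mul_le_mul_left h1 hpos
    have h4 : 0 ≤ (h : ℝ) ^ (2 - ε / 2) := by positivity
    have h3 := abs_le_of_sq_le_sq h2 (by positivity)
    linarith [le_abs_self (N : ℝ)]

section ExceptionalSet

variable {p : ℕ} [Fact p.Prime]

lemma diffCoeffs_root {h : ℕ} {s : ZMod p} {q : (Fin 3 → ℤ) × (Fin 3 → ℤ)}
    (hq : q ∈ solutions h s) :
    ((diffCoeffs q).1 : ZMod p) * s ^ 2 + ((diffCoeffs q).2.1 : ZMod p) * s +
      ((diffCoeffs q).2.2 : ZMod p) = 0 := by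
  have h1 := diffCoeffs_eval q s 1
  have h2 := (mem_solutions.mp hq).2.2.1
  simp only [one_mul, mul_one, one_pow] at h1
  rw [h1, sub_eq_zero]
  simpa only [add_comm] using h2

lemma isRationalSolution_of_mem {h : ℕ} {s : ZMod p} {q : (Fin 3 → ℤ) × (Fin 3 → ℤ)}
    (hq : q ∈ properSolutions h s) {u v : ℤ} (hv : (v : ZMod p) ≠ 0)
    (hs : (v : ZMod p) * s = u)
    (hroot : (diffCoeffs q).1 * u ^ 2 + (diffCoeffs q).2.1 * u * v +
      (diffCoeffs q).2.2 * v ^ 2 = 0) : IsRationalSolution h u v q := by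
  obtain ⟨hq1, hne⟩ := mem_properSolutions.mp hq
  obtain ⟨h1, h2, h3, h4⟩ := mem_solutions.mp hq1
  refine ⟨h1, h2, hne, ?_, fun i hi => ?_⟩
  · have h5 := diffCoeffs_eval q u v
    simp only [Int.cast_id] at h5
    rw [hroot, mul_zero] at h5
    exact (sub_eq_zero.mp h5.symm)
  · rw [h3] at h4
    apply Finset.prod_ne_zero_iff.mp h4 i (Finset.mem_univ _)
    have h6 : ((u + v * q.2 i : ℤ) : ZMod p) = 0 := by rw [hi, Int.cast_zero]
    push_cast at h6
    rw [← hs, ← mul_add, mul_eq_zero] at h6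
    rw [add_comm]
    exact h6.resolve_left hv

lemma card_properSolutions_le_mul_card_image {D h : ℕ}
    (hD : ∀ n : ℕ, n ≠ 0 → n ≤ h ^ 3 → n.divisors.card ≤ D) (s : ZMod p) :
    (properSolutions h s).card ≤
      (2 * D) ^ 4 * h * ((properSolutions h s).image diffCoeffs).card := by
  refine Finset.card_le_mul_card_image _ _ fun w _ => card_fiber_diffCoeffs_le hD _ w fun q hq => ?_
  obtain ⟨hq, hw⟩ := Finset.mem_filter.mp hq
  obtain ⟨hq1, hne⟩ := mem_properSolutions.mp hq
  exact ⟨(mem_solutions.mp hq1).1, (mem_solutions.mp hq1).2.1, hne, hw⟩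

lemma card_properSolutions_le {ε : ℝ} (hε : 0 < ε) (hε2 : ε < 2) {h D : ℕ} (hh : 5 ≤ h)
    (hp : (h : ℝ) ^ (4 + ε) ≤ p) (hD : ∀ n : ℕ, n ≠ 0 → n ≤ h ^ 18 → n.divisors.card ≤ D)
    (s : ZMod p)
    (hs : ∀ u v : ℤ, (v : ZMod p) ≠ 0 → (v : ZMod p) * s = u → |(v : ℝ)| ≤ (h : ℝ) ^ (ε / 2) →
      2 * (h : ℝ) ^ (1 + ε / 2) < |(u : ℝ)|) :
    ((properSolutions h s).card : ℝ) ≤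
      90000 * (D : ℝ) ^ 4 * (1 + Real.log h) * (h : ℝ) ^ (3 - ε / 2) := by
  have hh1 : (1 : ℝ) ≤ h := by exact_mod_cast (by omega : 1 ≤ h)
  have hh0 : (0 : ℝ) < h := by linarith
  have hD1 : 1 ≤ D := by simpa using hD 1 one_ne_zero (Nat.one_le_pow _ _ (by omega))
  have hD1' : (1 : ℝ) ≤ D := by exact_mod_cast hD1
  have hL : 0 ≤ Real.log h := Real.log_nonneg hh1
  have hD24 : (D : ℝ) ^ 2 ≤ (D : ℝ) ^ 4 := pow_le_pow_right₀ hD1' (by norm_num)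
  set P : ℝ := (h : ℝ) ^ (3 - ε / 2) with hP
  have hPpos : 0 < P := by positivity
  have hDL : (D : ℝ) ^ 4 * P ≤ (D : ℝ) ^ 4 * (1 + Real.log h) * P := by
    have : 0 ≤ (D : ℝ) ^ 4 * P * Real.log h := by positivity
    nlinarith
  have hDP : 0 ≤ (D : ℝ) ^ 4 * P := by positivity
  set A := properSolutions h s with hA
  set Λ := A.image diffCoeffs with hΛ
  have hp4 : (h : ℤ) ^ 4 < p := by
    have : (h : ℝ) ^ 4 < p := by
      refine lt_of_lt_of_le ?_ hp
      rw [← Real.rpow_natCast]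
      exact Real.rpow_lt_rpow_of_exponent_lt (by exact_mod_cast (by omega : 1 < h))
        (by push_cast; linarith)
    exact_mod_cast this
  have hhZ : (5 : ℤ) ≤ h := by exact_mod_cast hh
  have hp2 : 18 * (h : ℤ) ^ 2 < p := by
    have : (25 : ℤ) ≤ (h : ℤ) ^ 2 := by nlinarith
    nlinarith
  have hp3 : 2 * (h : ℤ) ^ 3 < p := by
    have : 0 ≤ (h : ℤ) ^ 3 := by positivity
    nlinarith
  by_cases hN : 7 * (h : ℤ) < Λ.card ∧ 5292 * (h : ℤ) ^ 6 < p * Λ.card ∧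
      15876 * (h : ℤ) ^ 8 < p * (Λ.card : ℤ) ^ 2
  · obtain ⟨u, v, hcop, hvp, hvs, hvle, hule, hroot⟩ :=
      exists_common_rational_root s (by linarith) hp2 hp3 Λ (by
        intro w hw
        obtain ⟨q, hq, rfl⟩ := Finset.mem_image.mp hw
        have hq1 := (mem_properSolutions.mp hq).1
        obtain ⟨c1, c2, -, -⟩ := mem_solutions.mp hq1
        obtain ⟨d1, d2, d3⟩ := abs_diffCoeffs_le c1 c2
        exact ⟨d1, d2, d3, diffCoeffs_root hq1⟩) hN.1 hN.2.1 hN.2.2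
    have hv0 : v ≠ 0 := by rintro rfl; simp at hvp
    have hrat : ∀ q ∈ A, IsRationalSolution h u v q := fun q hq =>
      isRationalSolution_of_mem hq hvp hvs (hroot _ (Finset.mem_image_of_mem _ hq))
    have huv : |u| + |v| * h ≤ (h : ℤ) ^ 6 := by
      have h3 : (125 : ℤ) ≤ (h : ℤ) ^ 3 := by
        calc (125 : ℤ) = 5 ^ 3 := by norm_num
          _ ≤ _ := by gcongr
      have : |v| * h ≤ 18 * (h : ℤ) ^ 2 * h := by gcongr
      nlinarith
    have hvpos : (0 : ℝ) < |(v : ℝ)| := abs_pos.mpr (by exact_mod_cast hv0)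
    by_cases hv : |(v : ℝ)| ≤ (h : ℝ) ^ (ε / 2)
    · have hu := hs u v hvp hvs hv
      have hRe : (h : ℝ) ^ (1 + ε / 2) = h * (h : ℝ) ^ (ε / 2) := by
        rw [Real.rpow_add hh0, Real.rpow_one]
      have hR : 0 < (h : ℝ) ^ (1 + ε / 2) := by positivity
      have := card_le_of_forall_large hD hcop hv0 huv A hrat hR (by
        intro t ht
        obtain ⟨t1, t2⟩ := Finset.mem_Icc.mp ht
        have t1' : (1 : ℝ) ≤ t := by exact_mod_cast t1
        have t2' : (t : ℝ) ≤ h := by exact_mod_cast t2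
        have h1 : |(v : ℝ) * t| ≤ h * (h : ℝ) ^ (ε / 2) := by
          rw [abs_mul, abs_of_pos (by linarith : (0 : ℝ) < t), mul_comm]
          gcongr
        have h2 := abs_add_le ((u : ℝ) + v * t) (-((v : ℝ) * t))
        rw [abs_neg, add_neg_cancel_right] at h2
        linarith)
      have e : 2 * (h : ℝ) ^ 4 * (2 * D) ^ 4 / (h : ℝ) ^ (1 + ε / 2) = 32 * ((D : ℝ) ^ 4 * P) := by
        rw [div_eq_iff hR.ne', hP]
        have : (h : ℝ) ^ (3 - ε / 2) * (h : ℝ) ^ (1 + ε / 2) = (h : ℝ) ^ 4 := by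
          rw [← Real.rpow_add hh0, ← Real.rpow_natCast]
          congr 1
          push_cast
          ring
        rw [← this]
        ring
      rw [e] at this
      linarith
    · have := card_le_of_large_denominator (by omega) hD hcop hv0 huv A hrat
      have hv' := (not_le.mp hv).le
      have hQ : 0 < (h : ℝ) ^ (ε / 2) := by positivity
      have e : (h : ℝ) ^ 3 / (h : ℝ) ^ (ε / 2) = P := by
        rw [hP, Real.rpow_sub hh0, ← Real.rpow_natCast]
        norm_num
      have h1 : 8 * (h : ℝ) ^ 3 * (2 * D) ^ 4 * (1 + Real.log h) / |(v : ℝ)| ≤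
          128 * ((D : ℝ) ^ 4 * (1 + Real.log h) * P) := by
        calc _ ≤ 8 * (h : ℝ) ^ 3 * (2 * D) ^ 4 * (1 + Real.log h) / (h : ℝ) ^ (ε / 2) := by gcongr
          _ = _ := by rw [← e]; ring
      have h2 : (h : ℝ) ^ 2 ≤ P := by
        rw [hP, ← Real.rpow_natCast]
        exact Real.rpow_le_rpow_of_exponent_le hh1 (by push_cast; linarith)
      have h3 : (2 * (D : ℝ)) ^ 2 * (h : ℝ) ^ 2 ≤ 4 * ((D : ℝ) ^ 4 * P) := by
        calc _ = 4 * ((D : ℝ) ^ 2 * (h : ℝ) ^ 2) := by ring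
          _ ≤ _ := by gcongr
      linarith
  · have h1 := card_le_of_few_polynomials hε hε2 hh hp hN
    have h2 : (A.card : ℝ) ≤ (2 * D) ^ 4 * h * Λ.card := by
      exact_mod_cast card_properSolutions_le_mul_card_image (p := p) (fun n hn hn' =>
        hD n hn (hn'.trans (Nat.pow_le_pow_right (by omega) (by norm_num)))) s
    have e : (h : ℝ) * (h : ℝ) ^ (2 - ε / 2) = P := by
      rw [hP, show 3 - ε / 2 = 1 + (2 - ε / 2) by ring, Real.rpow_add hh0, Real.rpow_one]
    have h3 : (A.card : ℝ) ≤ 84672 * ((D : ℝ) ^ 4 * P) := by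
      calc _ ≤ (2 * (D : ℝ)) ^ 4 * h * Λ.card := h2
        _ ≤ (2 * (D : ℝ)) ^ 4 * h * (5292 * (h : ℝ) ^ (2 - ε / 2)) := by gcongr
        _ = _ := by rw [← e]; ring
    linarith

lemma ncard_le_of_bounded_fractions {X Y : ℝ} (hX : 0 ≤ X) (hY : 0 ≤ Y) (B : Set (ZMod p))
    (hB : ∀ s ∈ B, ∃ u v : ℤ, (v : ZMod p) ≠ 0 ∧ (v : ZMod p) * s = u ∧ |(v : ℝ)| ≤ X ∧
      |(u : ℝ)| ≤ Y) : (B.ncard : ℝ) ≤ (2 * X + 1) * (2 * Y + 1) := by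
  classical
  set I : ℝ → Finset ℤ := fun Z => Finset.Icc (-⌊Z⌋) ⌊Z⌋ with hI
  have hmem : ∀ {Z : ℝ} {t : ℤ}, |(t : ℝ)| ≤ Z → t ∈ I Z := by
    intro Z t ht
    rw [abs_le] at ht
    refine Finset.mem_Icc.mpr ⟨?_, Int.le_floor.mpr ht.2⟩
    have : -t ≤ ⌊Z⌋ := Int.le_floor.mpr (by push_cast; linarith)
    linarith
  have hcard : ∀ {Z : ℝ}, 0 ≤ Z → ((I Z).card : ℝ) ≤ 2 * Z + 1 := by
    intro Z hZ
    have h0 : 0 ≤ ⌊Z⌋ := Int.floor_nonneg.mpr hZ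
    have h1 : ((I Z).card : ℤ) = 2 * ⌊Z⌋ + 1 := by
      rw [hI, Int.card_Icc, Int.toNat_of_nonneg (by linarith)]
      ring
    have h2 : ((I Z).card : ℝ) = 2 * ⌊Z⌋ + 1 := by exact_mod_cast h1
    linarith [Int.floor_le Z]
  have hsub : B ⊆ ↑((I X ×ˢ I Y).image fun r => (r.2 : ZMod p) * (r.1 : ZMod p)⁻¹) := by
    intro s hs
    obtain ⟨u, v, hv, hvs, h1, h2⟩ := hB s hs
    refine Finset.mem_coe.mpr (Finset.mem_image.mpr
      ⟨(v, u), Finset.mem_product.mpr ⟨hmem h1, hmem h2⟩, ?_⟩)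
    simp only
    rw [← hvs, mul_comm, inv_mul_cancel_left₀ hv]
  have h1 := Set.ncard_le_ncard hsub (Finset.finite_toSet _)
  rw [Set.ncard_coe_finset] at h1
  have h2 := h1.trans Finset.card_image_le
  rw [Finset.card_product] at h2
  calc (B.ncard : ℝ) ≤ ((I X).card * (I Y).card : ℕ) := by exact_mod_cast h2
    _ = ((I X).card : ℝ) * (I Y).card := by push_cast; rfl
    _ ≤ _ := by gcongr <;> [exact hcard hX; exact hcard hY]

lemma coe_solutions (h : ℕ) (s : ZMod p) :
    {xy : (Fin 3 → ℤ) × (Fin 3 → ℤ) |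
      (∀ i, 1 ≤ xy.1 i ∧ xy.1 i ≤ (h : ℤ)) ∧ (∀ i, 1 ≤ xy.2 i ∧ xy.2 i ≤ (h : ℤ)) ∧
      (∏ i, ((xy.1 i : ZMod p) + s)) = (∏ i, ((xy.2 i : ZMod p) + s)) ∧
      (∏ i, ((xy.1 i : ZMod p) + s)) ≠ 0} = solutions h s := by
  ext q
  rw [Finset.mem_coe, mem_solutions, mem_cube, mem_cube]
  rfl

end ExceptionalSet

lemma log_le_exp_log_div_log_log {h : ℕ} (hh : 3 ≤ h) :
    1 ≤ Real.log h ∧ 1 ≤ Real.log h / Real.log (Real.log h) ∧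
      Real.log h ≤ Real.exp (Real.log h / Real.log (Real.log h)) := by
  have hh0 : (3 : ℝ) ≤ h := by exact_mod_cast hh
  have hu : 1 < Real.log h := by
    rw [Real.lt_log_iff_exp_lt (by linarith)]
    linarith [Real.exp_one_lt_d9]
  set u := Real.log h with hu_def
  have hw : 0 < Real.log u := Real.log_pos hu
  set w := Real.log u with hw_def
  have hexp : Real.exp w = u := Real.exp_log (by linarith)
  have h1 : w ≤ Real.exp (w / 2) := by
    have h2 := Real.add_one_le_exp (w / 2 - 1)
    have h3 : Real.exp (w / 2) = Real.exp 1 * Real.exp (w / 2 - 1) := by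
      rw [← Real.exp_add]; ring_nf
    have h4 : (2 : ℝ) ≤ Real.exp 1 := by linarith [Real.exp_one_gt_d9]
    rw [h3]
    have h5 : 0 ≤ Real.exp (w / 2 - 1) := (Real.exp_pos _).le
    nlinarith
  have h2 : w * w ≤ u := by
    calc w * w ≤ Real.exp (w / 2) * Real.exp (w / 2) := by gcongr
      _ = u := by rw [← Real.exp_add, add_halves, hexp]
  have h3 : w ≤ u / w := (le_div_iff₀ hw).mpr h2
  refine ⟨hu.le, (le_div_iff₀ hw).mpr ?_, ?_⟩
  · linarith [Real.add_one_le_exp w]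
  · calc u = Real.exp w := hexp.symm
      _ ≤ _ := Real.exp_le_exp.mpr h3

lemma two_pow_le_exp {n : ℕ} {r : ℝ} (hr : 1 ≤ r) : (2 : ℝ) ^ n ≤ Real.exp (n * r) := by
  rw [mul_comm, Real.exp_mul, Real.rpow_natCast]
  gcongr
  linarith [Real.add_one_le_exp r]

lemma rpow_four_add_le {ε : ℝ} (hε : 0 < ε) {p h : ℕ}
    (hp : (h : ℝ) ≤ (p : ℝ) ^ ((1 : ℝ) / (4 + ε))) : (h : ℝ) ^ (4 + ε) ≤ p := by
  calc (h : ℝ) ^ (4 + ε) ≤ ((p : ℝ) ^ ((1 : ℝ) / (4 + ε))) ^ (4 + ε) := by gcongr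
    _ = p := by
      rw [← Real.rpow_mul (by positivity), one_div_mul_cancel (by linarith), Real.rpow_one]

/-- For `s` outside a small set of fractions, `K₃(p, h, s)` is close to `6 h ^ 3`. -/
lemma abs_card_solutions_sub_le_exp {p : ℕ} [Fact p.Prime] {ε c : ℝ} (hε : 0 < ε) (hε2 : ε < 2)
    (hc : 0 < c) {h : ℕ} (hh : 3 ≤ h)
    (hdiv : ∀ n : ℕ, n ≠ 0 → n ≤ h ^ 18 →
      (n.divisors.card : ℝ) ≤ Real.exp (c * (Real.log h / Real.log (Real.log h))))
    (hp : (h : ℝ) ^ (4 + ε) ≤ p) (s : ZMod p)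
    (hs : ∀ u v : ℤ, (v : ZMod p) ≠ 0 → (v : ZMod p) * s = u → |(v : ℝ)| ≤ (h : ℝ) ^ (ε / 2) →
      2 * (h : ℝ) ^ (1 + ε / 2) < |(u : ℝ)|) :
    |((solutions h s).card : ℝ) - 6 * (h : ℝ) ^ 3| ≤ (h : ℝ) ^ ((3 : ℝ) - ε / 2) *
      Real.exp ((22 + 4 * c) * Real.log h / Real.log (Real.log h)) := by
  obtain ⟨hL, hr, hLr⟩ := log_le_exp_log_div_log_log hh
  rw [mul_div_assoc]
  set r := Real.log h / Real.log (Real.log h) with hr_def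
  have hh1 : (1 : ℝ) ≤ h := by exact_mod_cast (by omega : 1 ≤ h)
  have h21 := two_pow_le_exp (n := 21) hr
  set P : ℝ := (h : ℝ) ^ ((3 : ℝ) - ε / 2) with hP
  have hP1 : 1 ≤ P := Real.one_le_rpow hh1 (by linarith)
  rcases lt_or_ge h 5 with h5 | h5
  · have h1 : ((solutions h s).card : ℝ) ≤ 4 ^ 3 * 4 ^ 3 := by
      have h2 : (solutions h s).card ≤ h ^ 3 * h ^ 3 := by
        refine (Finset.card_filter_le _ _).trans ?_
        rw [Finset.card_product, card_cube]
      have h3 : h ^ 3 * h ^ 3 ≤ 4 ^ 3 * 4 ^ 3 := by gcongr <;> omega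
      exact_mod_cast h2.trans h3
    have h2 : (0 : ℝ) ≤ (solutions h s).card := by positivity
    have h3 : (h : ℝ) ^ 3 ≤ 4 ^ 3 := by
      gcongr
      exact_mod_cast (by omega : h ≤ 4)
    have h4 : (0 : ℝ) ≤ (h : ℝ) ^ 3 := by positivity
    calc |((solutions h s).card : ℝ) - 6 * (h : ℝ) ^ 3| ≤ 2 ^ 21 := by
          rw [abs_le]
          constructor <;> linarith
      _ ≤ Real.exp ((21 : ℕ) * r) := h21
      _ ≤ 1 * Real.exp ((22 + 4 * c) * r) := by
          rw [one_mul]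
          gcongr
          push_cast
          linarith
      _ ≤ _ := by gcongr
  · set D : ℕ := ⌊Real.exp (c * r)⌋₊ with hD_def
    have hD : ∀ n : ℕ, n ≠ 0 → n ≤ h ^ 18 → n.divisors.card ≤ D := fun n hn hn' =>
      Nat.le_floor (hdiv n hn hn')
    have hD1 : (1 : ℝ) ≤ D := by
      exact_mod_cast (by simpa using hD 1 one_ne_zero (Nat.one_le_pow _ _ (by omega)) : 1 ≤ D)
    have hDe : (D : ℝ) ≤ Real.exp (c * r) := Nat.floor_le (Real.exp_pos _).le
    have hhp : h < p := by
      have : (h : ℝ) < p := by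
        refine lt_of_lt_of_le ?_ hp
        conv_lhs => rw [← Real.rpow_one (h : ℝ)]
        exact Real.rpow_lt_rpow_of_exponent_lt (by exact_mod_cast (by omega : 1 < h)) (by linarith)
      exact_mod_cast this
    have h1 := abs_card_solutions_sub_le hhp s
    have h2 := card_properSolutions_le hε hε2 h5 hp hD s hs
    have h3 : (h : ℝ) ^ 2 ≤ P := by
      rw [hP, ← Real.rpow_natCast]
      exact Real.rpow_le_rpow_of_exponent_le hh1 (by push_cast; linarith)
    set W := Real.exp r with hW
    have hW1 : 1 ≤ W := hL.trans hLr
    have hD4 : (1 : ℝ) ≤ (D : ℝ) ^ 4 := one_le_pow₀ hD1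
    have h4 : (h : ℝ) ^ 2 ≤ (D : ℝ) ^ 4 * W * P := by
      have : 1 ≤ (D : ℝ) ^ 4 * W := one_le_mul_of_one_le_of_one_le hD4 hW1
      nlinarith
    have h5' : 90000 * (D : ℝ) ^ 4 * (1 + Real.log h) * P ≤ 180000 * ((D : ℝ) ^ 4 * W * P) := by
      calc _ ≤ 90000 * (D : ℝ) ^ 4 * (2 * W) * P := by gcongr; linarith
        _ = _ := by ring
    have h6 : 0 ≤ (D : ℝ) ^ 4 * W * P := by positivity
    calc _ ≤ 2 ^ 21 * ((D : ℝ) ^ 4 * W * P) := by linarith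
      _ ≤ Real.exp ((21 : ℕ) * r) * (Real.exp (c * r) ^ 4 * W * P) := by gcongr
      _ = P * Real.exp ((22 + 4 * c) * r) := by
        rw [← Real.exp_nat_mul, hW, mul_comm P, ← mul_assoc, ← Real.exp_add, ← Real.exp_add]
        congr 2
        push_cast
        ring

/-- For fixed `0 < ε < 2` there are `C₁, C₂ > 0` such that for every prime `p` and
every integer `3 ≤ h ≤ p^{1/(4+ε)}`, the number of `s ∈ 𝔽_p` with
`|K₃(p,h,s) − 6h³| > h^{3−ε/2} exp(C₁ log h / log log h)` is at most `C₂·h^{1+ε}`. -/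
theorem stmt7 (ε : ℝ) (hε : 0 < ε) (hε2 : ε < 2) :
    ∃ C₁ C₂ : ℝ, 0 < C₁ ∧ 0 < C₂ ∧ ∀ p : ℕ, p.Prime → ∀ h : ℕ, 3 ≤ h →
      (h : ℝ) ≤ (p : ℝ) ^ ((1 : ℝ) / (4 + ε)) →
      (Set.ncard {s : ZMod p |
        |(Set.ncard {xy : (Fin 3 → ℤ) × (Fin 3 → ℤ) |
            (∀ i, 1 ≤ xy.1 i ∧ xy.1 i ≤ (h : ℤ)) ∧
            (∀ i, 1 ≤ xy.2 i ∧ xy.2 i ≤ (h : ℤ)) ∧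
            (∏ i, ((xy.1 i : ZMod p) + s)) = (∏ i, ((xy.2 i : ZMod p) + s)) ∧
            (∏ i, ((xy.1 i : ZMod p) + s)) ≠ 0} : ℝ) - 6 * (h : ℝ) ^ 3| >
          (h : ℝ) ^ ((3 : ℝ) - ε / 2) *
            Real.exp (C₁ * Real.log h / Real.log (Real.log h))} : ℝ)
        ≤ C₂ * (h : ℝ) ^ ((1 : ℝ) + ε) := by
  obtain ⟨c, hc, hdiv⟩ := exists_card_divisors_le 18
  refine ⟨22 + 4 * c, 15, by positivity, by norm_num, fun p hprime h hh hp => ?_⟩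
  have : Fact p.Prime := ⟨hprime⟩
  have hp' := rpow_four_add_le hε hp
  have hh1 : (1 : ℝ) ≤ h := by exact_mod_cast (by omega : 1 ≤ h)
  have hX : 1 ≤ (h : ℝ) ^ (ε / 2) := Real.one_le_rpow hh1 (by linarith)
  have hY : 1 ≤ (h : ℝ) ^ (1 + ε / 2) := Real.one_le_rpow hh1 (by linarith)
  refine (ncard_le_of_bounded_fractions (X := (h : ℝ) ^ (ε / 2))
    (Y := 2 * (h : ℝ) ^ (1 + ε / 2)) (by positivity) (by positivity) _ ?_).trans ?_
  · intro s hs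
    rw [Set.mem_ofPred_eq, coe_solutions, Set.ncard_coe_finset] at hs
    by_contra hcon
    push Not at hcon
    exact absurd (abs_card_solutions_sub_le_exp hε hε2 hc hh (hdiv h hh) hp' s hcon)
      (not_le.mpr hs)
  · have e : (h : ℝ) ^ (1 + ε) = (h : ℝ) ^ (ε / 2) * (h : ℝ) ^ (1 + ε / 2) := by
      rw [← Real.rpow_add (by linarith)]
      congr 1
      ring
    rw [e]
    calc _ ≤ (3 * (h : ℝ) ^ (ε / 2)) * (5 * (h : ℝ) ^ (1 + ε / 2)) := by
          gcongr <;> linarith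
      _ = _ := by ring
end
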